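/- arXiv:1309.7967 — 4 statements merged into one kernel-verified Lean document; each statement's English description precedes it below -/
import Mathlib

section
/- Let n ∈ ℕ, i ∈ {1, ..., n}, and x ∈ 𝒳^n. Then x_i ≥ 1/((n - i + 1)(s_i - 1)), with equality if and only if x_j = 1/s_j for j < i and x_j = 1/((n - i + 1)(s_i - 1)) for j ≥ i. -/
/-- Membership in the set `𝒳^n`: `x 1 + ⋯ + x n = 1`, `1 ≥ x 1 ≥ ⋯ ≥ x n ≥ 0`, and
the product-sum inequalities `x 1 ⋯ x j ≤ x (j+1) + ⋯ + x n` for `1 ≤ j ≤ n-1`. -/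
def memChi (n : ℕ) (x : ℕ → ℝ) : Prop :=
  (∑ i ∈ Finset.Icc 1 n, x i = 1) ∧ x 1 ≤ 1 ∧
  (∀ i, 1 ≤ i → i < n → x (i + 1) ≤ x i) ∧ 0 ≤ x n ∧
  (∀ j, 1 ≤ j → j ≤ n - 1 →
    (∏ i ∈ Finset.Icc 1 j, x i) ≤ ∑ i ∈ Finset.Icc (j + 1) n, x i)

open Finset in
theorem chi_core (a y : ℕ → ℝ) (ha : ∀ k, 0 < a k)
    (hP : ∀ j, ∏ k ∈ range j, a k = 1 - ∑ k ∈ range j, a k) (m : ℕ) :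
    (∀ k, k + 1 < m → y (k + 1) ≤ y k) → (∀ k, k < m → 0 ≤ y k) →
    (∀ j, 1 ≤ j → j ≤ m → ∏ k ∈ range j, y k ≤ 1 - ∑ k ∈ range j, y k) →
    ∑ k ∈ range m, y k ≤ ∑ k ∈ range m, a k ∧
    (∑ k ∈ range m, y k = ∑ k ∈ range m, a k → ∀ k, k < m → y k = a k) := by
  induction m using Nat.strong_induction_on with
  | _ m ih =>
  intro hmono hnn hprod
  rcases m with _ | M
  · simp
  by_cases hz : y M = 0
  · have h := (ih M (by omega) (fun k hk => hmono k (by omega)) (fun k hk => hnn k (by omega))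
      (fun j h1 h2 => hprod j h1 (by omega))).1
    have := ha M
    rw [sum_range_succ, sum_range_succ, hz]
    exact ⟨by linarith, fun h' => by linarith⟩
  have hM : 0 < y M := lt_of_le_of_ne (hnn M (by omega)) (Ne.symm hz)
  have hge : ∀ t, t ≤ M → 0 < y (M - t) := by
    intro t
    induction t with
    | zero => intro _; simpa using hM
    | succ t iht =>
      intro ht
      have h1 := iht (by omega)
      have h2 := hmono (M - (t + 1)) (by omega)
      rw [show M - (t + 1) + 1 = M - t by omega] at h2
      linarith
  have hpos : ∀ k, k < M + 1 → 0 < y k := by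
    intro k hk
    have := hge (M - k) (by omega)
    rwa [show M - (M - k) = k by omega] at this
  -- it suffices to treat the case of a large sum
  by_cases hlt : ∑ k ∈ range (M + 1), y k < ∑ k ∈ range (M + 1), a k
  · exact ⟨hlt.le, fun h => absurd h hlt.ne⟩
  push Not at hlt
  set d : ℕ → ℝ := fun k => Real.log (a k / y k) with hd
  have hDm : 0 ≤ ∑ k ∈ range (M + 1), d k := by
    have h1 : ∑ k ∈ range (M + 1), d k
        = Real.log (∏ k ∈ range (M + 1), (a k / y k)) := by
      rw [Real.log_prod]
      intro k hk
      exact (div_pos (ha k) (hpos k (mem_range.1 hk))).ne'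
    rw [h1]
    apply Real.log_nonneg
    rw [prod_div_distrib, one_le_div (prod_pos fun k hk => hpos k (mem_range.1 hk))]
    have := hprod (M + 1) (by omega) le_rfl
    rw [hP]; linarith
  obtain ⟨p, hp, hmin⟩ := exists_min_image (range (M + 1)) (fun j => ∑ k ∈ range j, d k)
    ⟨0, by simp⟩
  have hpM : p < M + 1 := mem_range.1 hp
  have hD : ∀ j, p ≤ j → j ≤ M + 1 → 0 ≤ ∑ k ∈ Ico p j, d k := by
    intro j h1 h2
    rw [sum_Ico_eq_sub _ h1]
    rcases Nat.lt_or_ge j (M + 1) with h | h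
    · have := hmin j (mem_range.2 h); linarith
    · obtain rfl : j = M + 1 := by omega
      have := hmin 0 (by simp)
      simp only [range_zero, sum_empty] at this; linarith
  have hAbel : ∀ j, p ≤ j → j ≤ M →
      y j * ∑ k ∈ Ico p j, d k ≤ ∑ k ∈ Ico p j, y k * d k := by
    intro j hj
    induction j, hj using Nat.le_induction with
    | base => simp
    | succ j hj ihj =>
      intro hjM
      have h1 := ihj (by omega)
      have h2 := hD (j + 1) (by omega) (by omega)
      have h3 := mul_le_mul_of_nonneg_right (hmono j (by omega)) h2
      rw [sum_Ico_succ_top hj] at h3 ⊢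
      rw [sum_Ico_succ_top hj]
      linarith
  have hAb : 0 ≤ ∑ k ∈ Ico p (M + 1), y k * d k := by
    have h1 := hAbel M (by omega) le_rfl
    have h2 := mul_nonneg hM.le (hD (M + 1) (by omega) le_rfl)
    rw [sum_Ico_succ_top (by omega)] at h2 ⊢
    linarith
  have hterm : ∀ k, k < M + 1 → y k * d k ≤ a k - y k := by
    intro k hk
    have h1 := hpos k hk
    have h2 := Real.log_le_sub_one_of_pos (div_pos (ha k) h1)
    have h3 := mul_le_mul_of_nonneg_left h2 h1.le
    have h4 : y k * (a k / y k - 1) = a k - y k := by field_simp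
    linarith
  have hterm' : ∀ k, k < M + 1 → y k * d k = a k - y k → y k = a k := by
    intro k hk he
    by_contra hne
    have h1 := hpos k hk
    have h2 := Real.log_lt_sub_one_of_pos (div_pos (ha k) h1)
      (fun h => hne ((div_eq_one_iff_eq h1.ne').1 h).symm)
    have h3 := mul_lt_mul_of_pos_left h2 h1
    have h4 : y k * (a k / y k - 1) = a k - y k := by field_simp
    simp only [hd] at he
    linarith
  have hS : ∑ k ∈ Ico p (M + 1), y k * d k ≤ ∑ k ∈ Ico p (M + 1), (a k - y k) :=
    sum_le_sum fun k hk => hterm k (mem_Ico.1 hk).2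
  have hI := ih p hpM (fun k hk => hmono k (by omega)) (fun k hk => hnn k (by omega))
      (fun j h1 h2 => hprod j h1 (by omega))
  have hS2 := hS
  rw [sum_sub_distrib] at hS2
  have hy := sum_range_add_sum_Ico y hpM.le
  have haa := sum_range_add_sum_Ico a hpM.le
  have hI1 := hI.1
  refine ⟨by linarith, fun he k hk => ?_⟩
  rcases Nat.lt_or_ge k p with h | h
  · exact hI.2 (by linarith) k h
  · have heq : ∑ k ∈ Ico p (M + 1), y k * d k = ∑ k ∈ Ico p (M + 1), (a k - y k) := by
      rw [sum_sub_distrib] at *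
      linarith
    exact hterm' k hk ((sum_eq_sum_iff_of_le fun k hk => hterm k (mem_Ico.1 hk).2).1 heq k
      (mem_Ico.2 ⟨h, hk⟩))

theorem chi_single_coordinate_bound (n : ℕ) (x : ℕ → ℝ) (hx : memChi n x)
    (s : ℕ → ℕ) (hs1 : s 1 = 2)
    (hs : ∀ i, 2 ≤ i → s i = (∏ j ∈ Finset.Icc 1 (i - 1), s j) + 1)
    (i : ℕ) (hi1 : 1 ≤ i) (hi2 : i ≤ n) :
    1 / (((n : ℝ) - i + 1) * ((s i : ℝ) - 1)) ≤ x i ∧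
    (x i = 1 / (((n : ℝ) - i + 1) * ((s i : ℝ) - 1)) ↔
      (∀ j, 1 ≤ j → j < i → x j = 1 / (s j : ℝ)) ∧
      (∀ j, i ≤ j → j ≤ n → x j = 1 / (((n : ℝ) - i + 1) * ((s i : ℝ) - 1)))) := by
  obtain ⟨hsum, -, hmono, hxn, hprod⟩ := hx
  have hIcc : ∀ j, Finset.Icc 1 j = Finset.Ico 1 (j + 1) := fun j => by ext; simp <;> omega
  have hsN : ∀ j, s (j + 1) = (∏ k ∈ Finset.range j, s (k + 1)) + 1 := by
    intro j
    rcases j with _ | j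
    · simp [hs1]
    · rw [hs (j + 1 + 1) (by omega), hIcc, Finset.prod_Ico_eq_prod_range]
      simp [add_comm]
  have hspos : ∀ j, 0 < s (j + 1) := fun j => by rw [hsN]; omega
  have hsR : ∀ j, (s (j + 1) : ℝ) - 1 = ∏ k ∈ Finset.range j, (s (k + 1) : ℝ) := by
    intro j; rw [hsN j]; push_cast; ring
  set a : ℕ → ℝ := fun k => 1 / (s (k + 1) : ℝ) with hadef
  have ha : ∀ k, 0 < a k := fun k => by
    have : (0 : ℝ) < s (k + 1) := by exact_mod_cast hspos k
    simp only [hadef]; positivity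
  have hPs : ∀ j, ∏ k ∈ Finset.range j, a k = 1 / ((s (j + 1) : ℝ) - 1) := by
    intro j; rw [hsR]; simp [hadef]
  have hsm : ∀ j, (0 : ℝ) < (s (j + 1) : ℝ) - 1 := by
    intro j; rw [hsR]
    exact Finset.prod_pos fun k _ => by exact_mod_cast hspos k
  have hP : ∀ j, ∏ k ∈ Finset.range j, a k = 1 - ∑ k ∈ Finset.range j, a k := by
    intro j
    induction j with
    | zero => simp
    | succ j ih =>
      have h2 : (∏ k ∈ Finset.range j, a k) * a j = ∏ k ∈ Finset.range j, a k - a j := by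
        rw [hPs]
        have h := hsm j
        have h' : (s (j + 1) : ℝ) ≠ 0 := by exact_mod_cast (hspos j).ne'
        simp only [hadef]
        field_simp
        ring
      rw [Finset.prod_range_succ, Finset.sum_range_succ]
      linarith
  have hanti : ∀ j k, 1 ≤ j → j ≤ k → k ≤ n → x k ≤ x j := by
    intro j k h1 h2
    induction k, h2 using Nat.le_induction with
    | base => intro _; exact le_rfl
    | succ k hk ih => intro h; exact (hmono k (by omega) (by omega)).trans (ih (by omega))
  have hsplit : ∀ j, j ≤ n →
      ∑ k ∈ Finset.Icc (j + 1) n, x k = 1 - ∑ k ∈ Finset.range j, x (k + 1) := by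
    intro j hj
    rw [← hsum, hIcc, show Finset.Icc (j + 1) n = Finset.Ico (j + 1) (n + 1) by ext; simp <;> omega,
      ← Finset.sum_Ico_consecutive x (show 1 ≤ j + 1 by omega) (show j + 1 ≤ n + 1 by omega),
      Finset.sum_Ico_eq_sum_range x 1 (j + 1)]
    simp [add_comm]
  obtain ⟨m, rfl⟩ : ∃ m, i = m + 1 := ⟨i - 1, by omega⟩
  have core := chi_core a (fun k => x (k + 1)) ha hP m
    (fun k hk => hmono (k + 1) (by omega) (by omega))
    (fun k hk => hxn.trans (hanti (k + 1) n (by omega) (by omega) le_rfl))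
    (fun j h1 h2 => by
      have := hprod j h1 (by omega)
      rw [hsplit j (by omega), hIcc, Finset.prod_Ico_eq_prod_range] at this
      simpa [add_comm] using this)
  have hT := hsplit m (by omega)
  have hle : ∀ k ∈ Finset.Icc (m + 1) n, x k ≤ x (m + 1) := fun k hk => by
    rw [Finset.mem_Icc] at hk; exact hanti _ _ (by omega) hk.1 hk.2
  have hN : (0 : ℝ) < (n : ℝ) - (m + 1 : ℕ) + 1 := by
    have : ((m + 1 : ℕ) : ℝ) ≤ n := by exact_mod_cast hi2
    linarith
  have hconst : ∑ _k ∈ Finset.Icc (m + 1) n, x (m + 1)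
      = ((n : ℝ) - (m + 1 : ℕ) + 1) * x (m + 1) := by
    rw [Finset.sum_const, Nat.card_Icc, nsmul_eq_mul, Nat.cast_sub (by omega)]
    push_cast; ring
  have hTle := Finset.sum_le_sum hle
  rw [hconst] at hTle
  have hPm := hP m
  rw [hPs] at hPm
  have hB : 1 / (((n : ℝ) - (m + 1 : ℕ) + 1) * ((s (m + 1) : ℝ) - 1))
      = (1 / ((s (m + 1) : ℝ) - 1)) / ((n : ℝ) - (m + 1 : ℕ) + 1) := by
    rw [div_div, mul_comm]
  have c1 := core.1
  refine ⟨?_, fun he => ?_, fun h => h.2 _ le_rfl hi2⟩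
  · rw [hB, div_le_iff₀ hN, mul_comm]
    linarith
  · have he' := he
    rw [hB, eq_div_iff hN.ne', mul_comm] at he'
    refine ⟨fun j h1 h2 => ?_, fun j h1 h2 => ?_⟩
    · have := core.2 (by linarith) (j - 1) (by omega)
      simpa [hadef, show j - 1 + 1 = j by omega] using this
    · rw [← he]
      exact (Finset.sum_eq_sum_iff_of_le hle).1 (by rw [hconst]; linarith) j
        (Finset.mem_Icc.2 ⟨h1, h2⟩)
end

section
/- Let S be a d-dimensional integral simplex in ℝ^d whose interior contains exactly one integer point, and let β_1 ≥ β_2 ≥ ... ≥ β_{d+1} > 0 be the barycentric coordinates of that point with respect to the vertices of S. Then for every i ∈ {1, ..., d+1}, β_i ≥ 1/((d - i + 2)(s_i - 1)), where (s_i) is the Sylvester sequence. -/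
open MeasureTheory in
theorem bary_minkowski {ι : Type} [Fintype ι] [DecidableEq ι] (b : ι → ℝ) (hb : ∀ i, 0 < b i)
    (hsum : ∑ i, b i < 1) (hprod : 1 - ∑ i, b i < ∏ i, b i) :
    ∃ t : ι → ℤ, t ≠ 0 ∧ ∀ i, |(t i : ℝ) - (∑ k, (t k : ℝ)) * b i| < b i := by
  let M : Matrix ι ι ℝ :=
    1 + Matrix.replicateCol Unit (fun i => -b i) * Matrix.replicateRow Unit (fun _ => (1 : ℝ))
  let A : (ι → ℝ) →ₗ[ℝ] (ι → ℝ) := Matrix.toLin' M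
  have hA : ∀ x i, A x i = x i - (∑ k, x k) * b i := by
    intro x i
    simp only [A, M, Matrix.toLin'_apply, Matrix.add_mulVec, Matrix.one_mulVec, Pi.add_apply]
    simp only [Matrix.mulVec, dotProduct, Matrix.mul_apply, Matrix.replicateCol_apply,
      Matrix.replicateRow_apply, Finset.univ_unique, Finset.sum_const, Finset.card_singleton]
    rw [Finset.sum_mul, sub_eq_add_neg, ← Finset.sum_neg_distrib]
    congr 1
    refine Finset.sum_congr rfl fun k _ => ?_
    simp
    ring
  have hdet : LinearMap.det A = 1 - ∑ i, b i := by
    simp only [A, LinearMap.det_toLin', M]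
    rw [Matrix.det_one_add_replicateCol_mul_replicateRow]
    simp [dotProduct, sub_eq_add_neg]
  have hpos : 0 < 1 - ∑ i, b i := by linarith
  let B : Set (ι → ℝ) := Set.pi Set.univ fun i => Set.Ioo (-b i) (b i)
  have hvol : volume (A ⁻¹' B) = ENNReal.ofReal (2 ^ Fintype.card ι * (∏ i, b i) / (1 - ∑ i, b i)) := by
    rw [Measure.addHaar_preimage_linearMap _ (by rw [hdet]; exact hpos.ne'), hdet]
    simp only [B]
    rw [Real.volume_pi_Ioo, ← ENNReal.ofReal_prod_of_nonneg (fun i _ => by linarith [hb i]),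
      ← ENNReal.ofReal_mul (abs_nonneg _), abs_of_pos (inv_pos.mpr hpos)]
    congr 1
    have : ∏ i, (b i - -b i) = 2 ^ Fintype.card ι * ∏ i, b i := by
      rw [← Finset.card_univ, ← Finset.prod_const, ← Finset.prod_mul_distrib]
      exact Finset.prod_congr rfl fun i _ => by ring
    rw [this]
    field_simp
  have hfund := ZSpan.isAddFundamentalDomain' (Pi.basisFun ℝ ι) (volume : Measure (ι → ℝ))
  have hF : volume (ZSpan.fundamentalDomain (Pi.basisFun ℝ ι)) = 1 := by
    rw [ZSpan.fundamentalDomain_pi_basisFun, Real.volume_pi_Ico]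
    simp
  have hBconv : Convex ℝ B := convex_pi fun i _ => convex_Ioo _ _
  have : Countable (Submodule.span ℤ (Set.range (Pi.basisFun ℝ ι))).toAddSubgroup :=
    inferInstanceAs (Countable (Submodule.span ℤ (Set.range (Pi.basisFun ℝ ι))))
  obtain ⟨x, hx0, hx⟩ := exists_ne_zero_mem_lattice_of_measure_mul_two_pow_lt_measure
    (s := A ⁻¹' B) hfund (by
      intro x hx
      simp only [Set.mem_preimage, B, Set.mem_pi, Set.mem_univ, true_imp_iff, map_neg,
        Pi.neg_apply, Set.mem_Ioo] at hx ⊢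
      intro i
      constructor <;> linarith [(hx i).1, (hx i).2]) (hBconv.linear_preimage A) (by
      rw [hF, hvol, one_mul, Module.finrank_fintype_fun_eq_card]
      rw [show (2 : ENNReal) ^ Fintype.card ι = ENNReal.ofReal (2 ^ Fintype.card ι) by
        rw [ENNReal.ofReal_pow (by norm_num)]; simp]
      rw [ENNReal.ofReal_lt_ofReal_iff_of_nonneg (by positivity), lt_div_iff₀ hpos]
      exact mul_lt_mul_of_pos_left hprod (by positivity))
  have hmem : ∀ i, ∃ z : ℤ, (z : ℝ) = (x : ι → ℝ) i := by
    have := ((Pi.basisFun ℝ ι).mem_span_iff_repr_mem ℤ (x : ι → ℝ)).mp x.2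
    intro i
    obtain ⟨z, hz⟩ := this i
    exact ⟨z, by simpa using hz⟩
  choose t ht using hmem
  refine ⟨t, ?_, ?_⟩
  · rintro rfl
    apply hx0
    ext i
    simp [← ht i]
  · intro i
    have := hx i (Set.mem_univ i)
    rw [hA] at this
    rw [abs_lt]
    simp only [ht]
    exact this

theorem bary_prod_le (d : ℕ)
    (v : Fin (d + 1) → Fin d → ℤ)
    (hind : AffineIndependent ℝ (fun i => fun j => (v i j : ℝ)))
    (p : Fin d → ℤ)
    (huniq : ∀ q : Fin d → ℤ, (fun j => (q j : ℝ)) ∈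
      interior (convexHull ℝ (Set.range (fun i => fun j => (v i j : ℝ)))) → q = p)
    (β : Fin (d + 1) → ℝ) (hβpos : ∀ i, 0 < β i) (hβsum : ∑ i, β i = 1)
    (hβbary : ∀ j, (p j : ℝ) = ∑ i, β i * (v i j : ℝ))
    (J : Finset (Fin (d + 1))) (i₀ : Fin (d + 1)) (hi₀ : i₀ ∉ J) :
    ∏ i ∈ J, β i ≤ 1 - ∑ i ∈ J, β i := by
  by_contra! hcon
  let b : AffineBasis (Fin (d + 1)) ℝ (Fin d → ℝ) :=
    ⟨fun i => fun j => (v i j : ℝ), hind,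
      hind.affineSpan_eq_top_iff_card_eq_finrank_add_one.mpr (by simp)⟩
  have hcoord : ∀ (γ : Fin (d + 1) → ℝ) (x : Fin d → ℝ), ∑ i, γ i = 1 →
      (∀ j, x j = ∑ i, γ i * (v i j : ℝ)) → ∀ i, b.coord i x = γ i := by
    intro γ x hγ hx i
    have : x = Finset.univ.affineCombination ℝ b γ := by
      rw [Finset.affineCombination_eq_linear_combination _ _ _ hγ]
      ext j
      rw [hx j]
      simp only [Finset.sum_apply, Pi.smul_apply, smul_eq_mul]
      rfl
    rw [this]
    exact b.coord_apply_combination_of_mem (Finset.mem_univ i) hγ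
  have hJlt : ∑ i ∈ J, β i < 1 := by
    rw [← hβsum]
    exact Finset.sum_lt_sum_of_subset (Finset.subset_univ J) (Finset.mem_univ i₀) hi₀ (hβpos i₀)
      (fun i _ _ => (hβpos i).le)
  have hβ1 : ∀ i ∈ J, β i < 1 := fun i hi =>
    (Finset.single_le_sum (fun k _ => (hβpos k).le) hi).trans_lt hJlt
  obtain ⟨t, ht0, ht⟩ := bary_minkowski (fun i : J => β i) (fun i => hβpos i)
    (by rw [Finset.sum_coe_sort J β]; exact hJlt)
    (by rw [Finset.sum_coe_sort J β, Finset.prod_coe_sort J β]; exact hcon)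
  have hm0 : ∑ k, t k ≠ 0 := by
    intro h
    apply ht0
    ext i
    have h1 := ht i
    have h2 : ∑ k, (t k : ℝ) = 0 := by exact_mod_cast h
    rw [h2, zero_mul, sub_zero] at h1
    have h3 : |(t i : ℝ)| < 1 := h1.trans (hβ1 i i.2)
    have h4 : |t i| < 1 := by exact_mod_cast h3
    simpa using Int.abs_lt_one_iff.mp h4
  obtain ⟨t, hm, ht⟩ : ∃ t : J → ℤ, 0 < ∑ k, t k ∧
      ∀ i, (t i : ℝ) - (∑ k, (t k : ℝ)) * β i < β i := by
    rcases lt_or_gt_of_ne hm0 with h | h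
    · refine ⟨-t, by simpa using h, fun i => ?_⟩
      have := (abs_lt.mp (ht i)).1
      simp only [Pi.neg_apply, Int.cast_neg, Finset.sum_neg_distrib]
      linarith
    · exact ⟨t, h, fun i => (abs_lt.mp (ht i)).2⟩
  let T : Fin (d + 1) → ℤ := fun i => if h : i ∈ J then t ⟨i, h⟩ else 0
  set m : ℤ := ∑ k, t k with hmdef
  have hT : ∑ i, T i = m := by
    rw [← Finset.sum_subset (Finset.subset_univ J) (fun i _ hi => by simp [T, hi]),
      ← Finset.sum_coe_sort J T]
    exact Finset.sum_congr rfl fun i _ => by simp [T]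
  have hTr : ∑ i, (T i : ℝ) = m := by exact_mod_cast hT
  have hmr : (0 : ℝ) < m := by exact_mod_cast hm
  let γ : Fin (d + 1) → ℝ := fun i => (m + 1) * β i - T i
  have hγsum : ∑ i, γ i = 1 := by
    simp only [γ, Finset.sum_sub_distrib, ← Finset.mul_sum, hβsum, hTr]
    ring
  let q : Fin d → ℤ := fun j => (m + 1) * p j - ∑ i, T i * v i j
  have hq : ∀ j, (q j : ℝ) = ∑ i, γ i * (v i j : ℝ) := by
    intro j
    simp only [q, γ]
    push_cast
    rw [hβbary j, Finset.mul_sum, ← Finset.sum_sub_distrib]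
    exact Finset.sum_congr rfl fun i _ => by ring
  have hcq := hcoord γ (fun j => (q j : ℝ)) hγsum hq
  have hqp : q = p := by
    apply huniq
    have hi := b.interior_convexHull
    change interior (convexHull ℝ (Set.range (fun i => fun j => (v i j : ℝ)))) = _ at hi
    rw [hi]
    intro i
    rw [hcq]
    simp only [γ, T]
    split_ifs with h
    · have := ht ⟨i, h⟩
      have h2 : ∑ k, (t k : ℝ) = m := by rw [hmdef]; push_cast; rfl
      rw [h2] at this
      simp only at this
      linarith
    · have := hβpos i
      push_cast
      rw [sub_zero]
      positivity
  have h1 := hcq i₀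
  rw [hqp, hcoord β _ hβsum hβbary i₀] at h1
  simp only [γ, T, hi₀, dite_false] at h1
  have := mul_pos hmr (hβpos i₀)
  push_cast at h1
  linarith

theorem bary_abel (D w : ℕ → ℝ) (n : ℕ)
    (hw : ∀ k, k + 1 ≤ n → w k ≤ w (k + 1))
    (hT : ∀ k ≤ n, ∑ i ∈ Finset.range k, D i ≤ 0) :
    (∑ i ∈ Finset.range (n + 1), D i) * w n ≤ ∑ i ∈ Finset.range (n + 1), D i * w i := by
  induction n with
  | zero => simp
  | succ n ih =>
    have h1 := ih (fun k hk => hw k (by omega)) (fun k hk => hT k (by omega))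
    rw [Finset.sum_range_succ, Finset.sum_range_succ _ (n + 1)]
    have h2 := hT (n + 1) le_rfl
    have h3 := hw n le_rfl
    nlinarith

theorem bary_sylvester_bound (x y : ℕ → ℝ) (N : ℕ) (hx : ∀ k < N, 0 < x k)
    (hanti : ∀ k, k + 1 < N → x (k + 1) ≤ x k)
    (hprod : ∀ k ≤ N, ∏ i ∈ Finset.range k, x i ≤ 1 - ∑ i ∈ Finset.range k, x i)
    (hy : ∀ k, 0 < y k)
    (hyp : ∀ k, ∏ i ∈ Finset.range k, y i = 1 - ∑ i ∈ Finset.range k, y i) :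
    ∀ k ≤ N, ∏ i ∈ Finset.range k, y i ≤ 1 - ∑ i ∈ Finset.range k, x i := by
  intro k
  induction k using Nat.strong_induction_on with
  | _ k ih =>
    intro hk
    by_contra! hcon
    rcases k with _ | n
    · simp at hcon
    have hT : ∀ j ≤ n, ∑ i ∈ Finset.range j, (x i - y i) ≤ 0 := by
      intro j hj
      have := ih j (by omega) (by omega)
      rw [hyp] at this
      rw [Finset.sum_sub_distrib]
      linarith
    have hTn : 0 < ∑ i ∈ Finset.range (n + 1), (x i - y i) := by
      rw [hyp] at hcon
      rw [Finset.sum_sub_distrib]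
      linarith
    have habel := bary_abel (fun i => x i - y i) (fun i => (x i)⁻¹) n
      (fun k hk' => inv_anti₀ (hx _ (by omega)) (hanti k (by omega))) hT
    have hpos : 0 < ∑ i ∈ Finset.range (n + 1), (x i - y i) * (x i)⁻¹ :=
      (mul_pos hTn (inv_pos.mpr (hx n (by omega)))).trans_le habel
    have hlog : ∑ i ∈ Finset.range (n + 1), (x i - y i) * (x i)⁻¹ ≤
        ∑ i ∈ Finset.range (n + 1), (Real.log (x i) - Real.log (y i)) := by
      refine Finset.sum_le_sum fun i hi => ?_
      have hxi := hx i (by have := Finset.mem_range.mp hi; omega)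
      have h1 := Real.log_le_sub_one_of_pos (div_pos (hy i) hxi)
      rw [Real.log_div (hy i).ne' hxi.ne'] at h1
      have h2 : (x i - y i) * (x i)⁻¹ = 1 - y i / x i := by field_simp
      rw [h2]
      linarith
    rw [Finset.sum_sub_distrib, ← Real.log_prod (fun i hi =>
        (hx i (by have := Finset.mem_range.mp hi; omega)).ne'),
      ← Real.log_prod (fun i _ => (hy i).ne')] at hlog
    have hlt : ∏ i ∈ Finset.range (n + 1), x i < ∏ i ∈ Finset.range (n + 1), y i :=
      (hprod _ hk).trans_lt hcon
    have := Real.log_lt_log (Finset.prod_pos fun i hi =>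
      hx i (by have := Finset.mem_range.mp hi; omega)) hlt
    linarith


/-- Let `S ⊂ ℝ^d` be a `d`-dimensional integral simplex whose interior contains
exactly one integer point, and let `β 0 ≥ β 1 ≥ ⋯ ≥ β d > 0` be the barycentric
coordinates of that point. Then `β i ≥ 1/((d - i + 1)(s (i+1) - 1))` for every
`i : Fin (d+1)` (in the paper's 1-based indexing: `β_i ≥ 1/((d-i+2)(s_i - 1))`),
where `s` is the Sylvester sequence. -/
theorem barycentric_coordinate_lower_bound (d : ℕ) (hd : 1 ≤ d)
    (s : ℕ → ℕ) (hs1 : s 1 = 2)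
    (hs : ∀ i, 2 ≤ i → s i = (∏ j ∈ Finset.Icc 1 (i - 1), s j) + 1)
    (v : Fin (d + 1) → Fin d → ℤ)
    (hind : AffineIndependent ℝ (fun i => fun j => (v i j : ℝ)))
    (S : Set (Fin d → ℝ))
    (hS : S = convexHull ℝ (Set.range (fun i => fun j => (v i j : ℝ))))
    (p : Fin d → ℤ) (hp : (fun j => (p j : ℝ)) ∈ interior S)
    (huniq : ∀ q : Fin d → ℤ, (fun j => (q j : ℝ)) ∈ interior S → q = p)
    (β : Fin (d + 1) → ℝ) (hβpos : ∀ i, 0 < β i) (hβsum : ∑ i, β i = 1)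
    (hβmono : ∀ i j : Fin (d + 1), i ≤ j → β j ≤ β i)
    (hβbary : ∀ j, (p j : ℝ) = ∑ i, β i * (v i j : ℝ)) :
    ∀ i : Fin (d + 1),
      1 / (((d : ℝ) - (i : ℕ) + 1) * ((s ((i : ℕ) + 1) : ℝ) - 1)) ≤ β i := by
  subst hS
  let x : ℕ → ℝ := fun n => if h : n < d + 1 then β ⟨n, h⟩ else 0
  have hxβ : ∀ i : Fin (d + 1), x i = β i := fun i => dif_pos i.2
  have hIcc : ∀ n, ∏ j ∈ Finset.Icc 1 n, s j = ∏ j ∈ Finset.range n, s (j + 1) := by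
    intro n
    induction n with
    | zero => simp
    | succ n ih => rw [Finset.prod_Icc_succ_top (by omega), ih, Finset.prod_range_succ]
  have hs' : ∀ n, s (n + 1) = (∏ j ∈ Finset.range n, s (j + 1)) + 1 := by
    intro n
    rcases n with _ | n
    · simp [hs1]
    · rw [hs (n + 1 + 1) (by omega), ← hIcc]
      rfl
  have hspos : ∀ n, (0 : ℝ) < s (n + 1) := by
    intro n
    rw [hs']
    positivity
  have hsr : ∀ n, (s (n + 1) : ℝ) - 1 = ∏ j ∈ Finset.range n, (s (j + 1) : ℝ) := by
    intro n
    rw [hs']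
    push_cast
    ring
  let y : ℕ → ℝ := fun n => ((s (n + 1) : ℝ))⁻¹
  have hyp : ∀ k, ∏ i ∈ Finset.range k, y i = 1 - ∑ i ∈ Finset.range k, y i := by
    intro k
    induction k with
    | zero => simp
    | succ k ih =>
      rw [Finset.sum_range_succ, ← sub_sub, ← ih, Finset.prod_range_succ]
      have h1 : ∏ i ∈ Finset.range k, y i = ((s (k + 1) : ℝ) - 1)⁻¹ := by
        rw [hsr, ← Finset.prod_inv_distrib]
      have h2 : (s (k + 1) : ℝ) - 1 ≠ 0 := by
        rw [hsr]
        exact (Finset.prod_pos fun i _ => hspos i).ne'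
      have h3 := (hspos k).ne'
      rw [h1]
      simp only [y]
      field_simp
      ring
  have hprod : ∀ k ≤ d, ∏ i ∈ Finset.range k, x i ≤ 1 - ∑ i ∈ Finset.range k, x i := by
    intro k hk
    have h := bary_prod_le d v hind p huniq β hβpos hβsum hβbary
      (Finset.univ.map (Fin.castLEEmb (show k ≤ d + 1 by omega))) (Fin.last d) (by
        simp only [Finset.mem_map, Finset.mem_univ, true_and, not_exists]
        intro a ha
        have := congrArg Fin.val ha
        simp at this
        omega)
    rw [Finset.prod_map, Finset.sum_map] at h
    rw [Finset.prod_range, Finset.sum_range]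
    have e : ∀ a : Fin k, x a = β (Fin.castLEEmb (show k ≤ d + 1 by omega) a) := fun a => by
      rw [← hxβ]; rfl
    simp only [e]
    exact h
  have key := bary_sylvester_bound x y d
    (fun k hk => by simp only [x]; rw [dif_pos (by omega)]; exact hβpos _)
    (fun k hk => by
      simp only [x]
      rw [dif_pos (by omega), dif_pos (by omega)]
      exact hβmono _ _ (by simp [Fin.le_def]))
    hprod (fun k => inv_pos.mpr (hspos k)) hyp
  intro i
  have hid : (i : ℕ) ≤ d := by omega
  have h1 := key i hid
  have htot : ∑ k ∈ Finset.range (d + 1), x k = 1 := by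
    rw [Finset.sum_range, ← hβsum]
    exact Finset.sum_congr rfl fun k _ => hxβ k
  have hsplit := Finset.sum_range_add_sum_Ico x (show (i : ℕ) ≤ d + 1 by omega)
  have hle : ∑ k ∈ Finset.Ico (i : ℕ) (d + 1), x k ≤ ((d : ℝ) - (i : ℕ) + 1) * β i := by
    have := Finset.sum_le_card_nsmul (Finset.Ico (i : ℕ) (d + 1)) x (β i) (by
      intro k hk
      rw [Finset.mem_Ico] at hk
      simp only [x]
      rw [dif_pos hk.2]
      exact hβmono _ _ (by rw [Fin.le_def]; exact hk.1))
    rw [Nat.card_Ico, nsmul_eq_mul, Nat.cast_sub (by omega)] at this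
    push_cast at this
    linarith
  have hprodinv : ∏ k ∈ Finset.range (i : ℕ), y k = ((s ((i : ℕ) + 1) : ℝ) - 1)⁻¹ := by
    rw [hsr, ← Finset.prod_inv_distrib]
  have hspos' : 0 < (s ((i : ℕ) + 1) : ℝ) - 1 := by
    rw [hsr]
    exact Finset.prod_pos fun i _ => hspos i
  have hidr : ((i : ℕ) : ℝ) ≤ d := by exact_mod_cast hid
  have hc : (0 : ℝ) < (d : ℝ) - (i : ℕ) + 1 := by linarith
  rw [hprodinv] at h1
  rw [one_div, mul_inv, inv_mul_le_iff₀ hc]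
  linarith
end

section
/- Let S ⊂ ℝ^d be a d-dimensional simplex with exactly one interior integer point whose barycentric coordinates with respect to S are (1/s_1, ..., 1/s_{d-1}, 1/(s_{d+1} - 1)) together with the last coordinate 1/(s_{d+1} - 1) being associated with a vertex placed at the origin. More precisely: if β_{d+1} = 1/(s_{d+1} - 1) is attained, then S is unimodularly equivalent to conv({0, s_1 e_1, ..., s_d e_d}). -/
theorem abel_aux (a b : ℕ → ℝ) (n : ℕ) (hb : ∀ i ≤ n, 0 < b i)
    (hanti : ∀ i < n, b (i + 1) ≤ b i)
    (hD : ∀ k ≤ n, 0 ≤ ∑ i ∈ Finset.range k, (a i - b i)) :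
    ∑ i ∈ Finset.range (n + 1), (a i - b i) / b i ≤
      (∑ i ∈ Finset.range (n + 1), (a i - b i)) / b n := by
  induction n with
  | zero => simp
  | succ n ih =>
    have ih' := ih (fun i hi => hb i (by omega)) (fun i hi => hanti i (by omega))
      (fun k hk => hD k (by omega))
    rw [Finset.sum_range_succ, Finset.sum_range_succ (fun i => a i - b i) (n + 1), add_div]
    have h1 : (∑ i ∈ Finset.range (n + 1), (a i - b i)) / b n ≤
        (∑ i ∈ Finset.range (n + 1), (a i - b i)) / b (n + 1) :=
      div_le_div_of_nonneg_left (hD _ le_rfl) (hb _ le_rfl) (hanti n (by omega))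
    linarith

theorem majorize_aux (a b : ℕ → ℝ) (n : ℕ) (ha : ∀ i ≤ n, 0 < a i) (hb : ∀ i ≤ n, 0 < b i)
    (hanti : ∀ i < n, b (i + 1) ≤ b i)
    (hD : ∀ k ≤ n, 0 ≤ ∑ i ∈ Finset.range k, (a i - b i))
    (hDn : ∑ i ∈ Finset.range (n + 1), (a i - b i) ≤ 0)
    (hprod : ∏ i ∈ Finset.range (n + 1), b i ≤ ∏ i ∈ Finset.range (n + 1), a i) :
    ∀ i ≤ n, a i = b i := by
  have h1 := abel_aux a b n hb hanti hD
  have h2 : ∑ i ∈ Finset.range (n + 1), (a i - b i) / b i ≤ 0 :=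
    h1.trans (div_nonpos_of_nonpos_of_nonneg hDn (hb n le_rfl).le)
  have hr : ∀ i ∈ Finset.range (n + 1), i ≤ n := fun i hi => by
    simp at hi; omega
  have h3 : 0 ≤ ∑ i ∈ Finset.range (n + 1), Real.log (a i / b i) := by
    rw [← Real.log_prod (fun i hi => (div_pos (ha i (hr i hi)) (hb i (hr i hi))).ne'),
      Finset.prod_div_distrib]
    apply Real.log_nonneg
    rw [one_le_div (Finset.prod_pos fun i hi => hb i (hr i hi))]
    exact hprod
  have h4 : ∀ i ∈ Finset.range (n + 1), 0 ≤ (a i - b i) / b i - Real.log (a i / b i) := by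
    intro i hi
    have hbi := hb i (hr i hi)
    have := Real.log_le_sub_one_of_pos (div_pos (ha i (hr i hi)) hbi)
    rw [sub_div, div_self hbi.ne']
    linarith
  have h5 : ∑ i ∈ Finset.range (n + 1), ((a i - b i) / b i - Real.log (a i / b i)) = 0 := by
    apply le_antisymm
    · rw [Finset.sum_sub_distrib]; linarith
    · exact Finset.sum_nonneg h4
  rw [Finset.sum_eq_zero_iff_of_nonneg h4] at h5
  intro i hi
  by_contra hne
  have hbi := hb i hi
  have := Real.log_lt_sub_one_of_pos (div_pos (ha i hi) hbi) (by
    intro h; rw [div_eq_one_iff_eq hbi.ne'] at h; exact hne h)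
  have h6 := h5 i (by simp; omega)
  rw [sub_div, div_self hbi.ne'] at h6
  linarith

/-- The extremal characterisation of the Sylvester reciprocals. -/
theorem sylvester_extremal (a b : ℕ → ℝ) (n : ℕ) (ha : ∀ i ≤ n, 0 < a i)
    (hb : ∀ i ≤ n, 0 < b i)
    (hanti : ∀ i < n, b (i + 1) ≤ b i)
    (haeq : ∀ k ≤ n + 1, ∏ i ∈ Finset.range k, a i = 1 - ∑ i ∈ Finset.range k, a i)
    (hble : ∀ k ≤ n + 1, 1 ≤ k → ∏ i ∈ Finset.range k, b i ≤ 1 - ∑ i ∈ Finset.range k, b i)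
    (hlast : 1 - ∑ i ∈ Finset.range (n + 1), b i = ∏ i ∈ Finset.range (n + 1), a i) :
    ∀ i ≤ n, a i = b i := by
  have hD : ∀ k ≤ n, 0 ≤ ∑ i ∈ Finset.range k, (a i - b i) := by
    intro k
    induction k using Nat.strong_induction_on with
    | _ k ih =>
      intro hk
      by_contra hneg
      push Not at hneg
      rcases k with _ | k
      · simp at hneg
      have := majorize_aux a b k (fun i hi => ha i (by omega)) (fun i hi => hb i (by omega))
        (fun i hi => hanti i (by omega)) (fun m hm => ih m (by omega) (by omega)) hneg.le (by
          rw [haeq _ (by omega)]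
          refine (hble _ (by omega) (by omega)).trans ?_
          rw [Finset.sum_sub_distrib] at hneg
          linarith)
      rw [Finset.sum_eq_zero] at hneg
      · exact lt_irrefl _ hneg
      · intro i hi
        rw [this i (by simp at hi; omega), sub_self]
  apply majorize_aux a b n ha hb hanti hD
  · rw [Finset.sum_sub_distrib]
    have := haeq (n + 1) le_rfl
    linarith
  · rw [← hlast]; exact hble _ le_rfl (by omega)

open MeasureTheory in
theorem mink_aux {ι : Type*} [Fintype ι] [DecidableEq ι] (x : ι → ℝ) (hx : ∀ i, 0 < x i)
    (hσ : 0 < 1 - ∑ i, x i) (hprod : 1 - ∑ i, x i < ∏ i, x i) :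
    ∃ n : ι → ℤ, n ≠ 0 ∧ ∀ i, |(n i : ℝ) - x i * ∑ k, (n k : ℝ)| < x i := by
  set M : Matrix ι ι ℝ := 1 - (Matrix.replicateCol Unit x : Matrix ι Unit ℝ) *
    (Matrix.replicateRow Unit (1 : ι → ℝ) : Matrix Unit ι ℝ) with hM
  have hdet : M.det = 1 - ∑ i, x i := by
    rw [hM, Matrix.det_one_sub_mul_comm, Matrix.det_unique]
    simp [Matrix.mul_apply]
  have hMv : ∀ (y : ι → ℝ) i, M.mulVec y i = y i - x i * ∑ k, y k := by
    intro y i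
    rw [hM, Matrix.sub_mulVec, Matrix.one_mulVec]
    simp [Matrix.mulVec, dotProduct, Matrix.mul_apply, Finset.mul_sum]
  set f := Matrix.toLin' M with hf
  have hfd : LinearMap.det f = 1 - ∑ i, x i := by rw [hf, LinearMap.det_toLin', hdet]
  set B : Set (ι → ℝ) := Set.pi Set.univ fun i => Set.Ioo (-x i) (x i) with hB
  have hvol : volume (f ⁻¹' B) = ENNReal.ofReal ((1 - ∑ i, x i)⁻¹ * (2 ^ Fintype.card ι * ∏ i, x i)) := by
    rw [Measure.addHaar_preimage_linearMap _ (by rw [hfd]; exact hσ.ne'), hfd,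
      abs_of_pos (inv_pos.2 hσ), ENNReal.ofReal_mul (inv_pos.2 hσ).le]
    congr 1
    rw [hB, volume_pi, Measure.pi_pi]
    simp_rw [Real.volume_Ioo]
    rw [← ENNReal.ofReal_prod_of_nonneg (fun i _ => by linarith [hx i])]
    congr 1
    simp_rw [sub_neg_eq_add, ← two_mul]
    rw [Finset.prod_mul_distrib]; simp
  have hF : volume (ZSpan.fundamentalDomain (Pi.basisFun ℝ ι)) = 1 := by
    rw [ZSpan.fundamentalDomain_pi_basisFun, volume_pi, Measure.pi_pi]
    simp
  have : Countable (Submodule.span ℤ (Set.range (Pi.basisFun ℝ ι))).toAddSubgroup :=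
    inferInstanceAs (Countable (Submodule.span ℤ (Set.range (Pi.basisFun ℝ ι))))
  obtain ⟨y, hy0, hy⟩ := exists_ne_zero_mem_lattice_of_measure_mul_two_pow_lt_measure
    (ZSpan.isAddFundamentalDomain' (Pi.basisFun ℝ ι) volume) (s := f ⁻¹' B)
    (by
      intro y hy
      simp only [Set.mem_preimage, hB, Set.mem_pi, Set.mem_univ, true_imp_iff, Set.mem_Ioo,
        map_neg, Pi.neg_apply] at hy ⊢
      intro i
      constructor <;> linarith [(hy i).1, (hy i).2])
    ((convex_pi fun i _ => convex_Ioo _ _).linear_preimage f)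
    (by
      rw [hF, hvol, one_mul, Module.finrank_fintype_fun_eq_card]
      rw [show (2 : ENNReal) ^ Fintype.card ι = ENNReal.ofReal (2 ^ Fintype.card ι) by
        rw [ENNReal.ofReal_pow (by norm_num)]; simp]
      rw [ENNReal.ofReal_lt_ofReal_iff_of_nonneg (by positivity)]
      rw [inv_mul_eq_div, lt_div_iff₀ hσ]
      exact mul_lt_mul_of_pos_left hprod (by positivity))
  have hmem : (y : ι → ℝ) ∈ Submodule.span ℤ (Set.range (Pi.basisFun ℝ ι)) := y.2
  rw [Module.Basis.mem_span_iff_repr_mem] at hmem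
  choose n hn using hmem
  have hn' : ∀ i, (n i : ℝ) = (y : ι → ℝ) i := by
    intro i; simpa using hn i
  refine ⟨n, ?_, ?_⟩
  · rintro rfl
    apply hy0
    ext i
    rw [← hn']; simp
  · intro i
    have := hy
    simp only [Set.mem_preimage, hB, Set.mem_pi, Set.mem_univ, true_imp_iff, Set.mem_Ioo, hf,
      Matrix.toLin'_apply, hMv] at this
    rw [abs_lt]
    simp_rw [hn']
    exact this i

/-- Extension of `mink_aux` to subsets. -/
theorem mink_finset {ι : Type*} [Fintype ι] [DecidableEq ι] (x : ι → ℝ) (hx : ∀ i, 0 < x i)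
    (J : Finset ι)
    (hσ : 0 < 1 - ∑ i ∈ J, x i) (hprod : 1 - ∑ i ∈ J, x i < ∏ i ∈ J, x i) :
    ∃ n : ι → ℤ, n ≠ 0 ∧ (∀ i ∉ J, n i = 0) ∧
      ∀ i ∈ J, |(n i : ℝ) - x i * ∑ k, (n k : ℝ)| < x i := by
  obtain ⟨n, hn0, hn⟩ := mink_aux (fun i : J => x i) (fun i => hx i)
    (by rwa [Finset.sum_coe_sort J x])
    (by rwa [Finset.sum_coe_sort J x, Finset.prod_coe_sort J x])
  refine ⟨fun i => if h : i ∈ J then n ⟨i, h⟩ else 0, ?_, ?_, ?_⟩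
  · intro h
    apply hn0
    ext i
    have := congrFun h i
    simpa using this
  · intro i hi; simp [hi]
  · intro i hi
    have := hn ⟨i, hi⟩
    have hs : ∑ k, (((if h : k ∈ J then n ⟨k, h⟩ else 0 : ℤ)) : ℝ) = ∑ k : J, (n k : ℝ) := by
      rw [← Finset.sum_subset (Finset.subset_univ J) (by intro k _ hk; simp [hk]),
        ← Finset.sum_coe_sort J]
      apply Finset.sum_congr rfl
      intro k _
      simp
    simp only [hs, hi, dite_true]
    exact this

/-- Sum-product inequality. -/
theorem sum_product {ι : Type*} [Fintype ι] [DecidableEq ι] (x : ι → ℝ) (hx : ∀ i, 0 < x i)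
    (hsum : ∑ i, x i = 1)
    (hu : ∀ (m : ℤ) (n : ι → ℤ), ∑ i, n i = m → (∀ i, 0 < (m + 1) * x i - n i) →
      ∀ i, (m + 1) * x i - n i = x i)
    (J : Finset ι) (hJ : J ≠ Finset.univ) :
    ∏ i ∈ J, x i ≤ 1 - ∑ i ∈ J, x i := by
  by_contra hcon
  push Not at hcon
  obtain ⟨l, hl⟩ : ∃ l, l ∉ J := by
    by_contra h; push Not at h
    exact hJ (Finset.eq_univ_iff_forall.2 h)
  have hle : ∑ i ∈ J, x i + x l ≤ 1 := by
    rw [← hsum, add_comm, ← Finset.sum_insert hl]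
    exact Finset.sum_le_sum_of_subset_of_nonneg (Finset.subset_univ _) fun i _ _ => (hx i).le
  have hJ1 : ∀ i ∈ J, x i < 1 := by
    intro i hi
    have := Finset.single_le_sum (f := x) (fun i _ => (hx i).le) hi
    linarith [hx l]
  have key : ∃ n : ι → ℤ, n ≠ 0 ∧ (∀ i ∉ J, n i = 0) ∧
      (∀ i ∈ J, |(n i : ℝ) - x i * ∑ k, (n k : ℝ)| < x i) ∧ 0 ≤ ∑ k, n k := by
    obtain ⟨n, h0, h1, h2⟩ := mink_finset x hx J (by linarith [hx l]) hcon
    rcases le_total 0 (∑ k, n k) with h | h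
    · exact ⟨n, h0, h1, h2, h⟩
    · refine ⟨-n, by simpa using h0, by simpa using h1, ?_, by simpa using h⟩
      intro i hi
      rw [← abs_neg]
      convert h2 i hi using 2
      simp; ring
  obtain ⟨n, h0, h1, h2, h3⟩ := key
  have h2' : ∀ i ∈ J, |(n i : ℝ) - x i * ((∑ k, n k : ℤ) : ℝ)| < x i := by
    intro i hi; push_cast; exact h2 i hi
  have hm : 1 ≤ ∑ k, n k := by
    rcases h3.eq_or_lt with h | h
    · exfalso
      apply h0
      ext i
      by_cases hi : i ∈ J
      · have := h2' i hi
        rw [← h] at this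
        simp only [Int.cast_zero, mul_zero, sub_zero] at this
        have h4 : |(n i : ℝ)| < 1 := this.trans (hJ1 i hi)
        have : |n i| < 1 := by exact_mod_cast h4
        simpa using Int.abs_lt_one_iff.1 this
      · simpa using h1 i hi
    · exact h
  have hm' : (1 : ℝ) ≤ ((∑ k, n k : ℤ) : ℝ) := by exact_mod_cast hm
  have := hu (∑ k, n k) n rfl (by
    intro i
    by_cases hi : i ∈ J
    · have := (abs_lt.1 (h2' i hi)).2
      linarith
    · rw [h1 i hi]
      have := mul_pos (show 0 < ((∑ k, n k : ℤ) : ℝ) + 1 by linarith) (hx i)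
      simpa using this) l
  rw [h1 l hl] at this
  have h5 : ((∑ k, n k : ℤ) : ℝ) * x l = 0 := by
    simp only [Int.cast_zero, sub_zero] at this; linarith
  have := mul_pos (show 0 < ((∑ k, n k : ℤ) : ℝ) by linarith) (hx l)
  linarith

theorem simplex_facts (d : ℕ) (v : Fin (d + 1) → Fin d → ℤ)
    (hind : AffineIndependent ℝ (fun i => fun j => (v i j : ℝ)))
    (p : Fin d → ℤ)
    (huniq : ∀ q : Fin d → ℤ, (fun j => (q j : ℝ)) ∈
      interior (convexHull ℝ (Set.range (fun i => fun j => (v i j : ℝ)))) → q = p)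
    (β : Fin (d + 1) → ℝ) (hβsum : ∑ i, β i = 1)
    (hβbary : ∀ j, (p j : ℝ) = ∑ i, β i * (v i j : ℝ)) :
    (∀ γ : Fin (d + 1) → ℝ, (∀ i, 0 < γ i) → ∑ i, γ i = 1 →
      (∃ q : Fin d → ℤ, ∀ j, (q j : ℝ) = ∑ i, γ i * (v i j : ℝ)) → γ = β) ∧
    (∀ x : Fin d → ℝ, ∃ γ : Fin (d + 1) → ℝ, ∑ i, γ i = 1 ∧
      ∀ j, x j = ∑ i, γ i * (v i j : ℝ)) := by
  have htop : affineSpan ℝ (Set.range (fun i => fun j => (v i j : ℝ))) = ⊤ := by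
    rw [hind.affineSpan_eq_top_iff_card_eq_finrank_add_one]
    simp
  let B : AffineBasis (Fin (d + 1)) ℝ (Fin d → ℝ) := ⟨fun i => fun j => (v i j : ℝ), hind, htop⟩
  have hB : ∀ i j, B i j = (v i j : ℝ) := fun i j => rfl
  have hcoord : ∀ (γ : Fin (d + 1) → ℝ) (x : Fin d → ℝ), ∑ i, γ i = 1 →
      (∀ j, x j = ∑ i, γ i * (v i j : ℝ)) → ∀ i, B.coord i x = γ i := by
    intro γ x hγ hx i
    rw [← B.coord_apply_combination_of_mem (Finset.mem_univ i) hγ]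
    congr 1
    rw [Finset.affineCombination_eq_linear_combination _ _ _ hγ]
    ext j
    rw [hx j]
    simp [hB]
  constructor
  · rintro γ hpos hsum ⟨q, hq⟩
    have h1 := hcoord γ _ hsum hq
    have hqp : q = p := by
      apply huniq
      have := B.interior_convexHull
      change interior (convexHull ℝ (Set.range (fun i => fun j => (v i j : ℝ)))) = _ at this
      rw [this]
      intro i
      rw [h1]
      exact hpos i
    subst hqp
    have h2 := hcoord β _ hβsum hβbary
    ext i
    rw [← h1, ← h2]
  · intro x
    refine ⟨fun i => B.coord i x, B.sum_coord_apply_eq_one x, ?_⟩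
    intro j
    have := congrFun (B.linear_combination_coord_eq_self x) j
    rw [← this]
    simp [hB]

theorem sylv_prod (s : ℕ → ℕ) (hs1 : s 1 = 2)
    (hs : ∀ i, 2 ≤ i → s i = (∏ j ∈ Finset.Icc 1 (i - 1), s j) + 1) (k : ℕ) :
    s (k + 1) = (∏ i ∈ Finset.range k, s (i + 1)) + 1 := by
  rcases k with _ | k
  · simp [hs1]
  · rw [hs _ (by omega)]
    congr 1
    rw [Nat.add_sub_cancel, Finset.range_eq_Ico, Finset.prod_Ico_add' s 0 (k + 1) 1]
    rfl

theorem sylv_sum (s : ℕ → ℕ)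
    (hs : ∀ k, s (k + 1) = (∏ i ∈ Finset.range k, s (i + 1)) + 1) (k : ℕ) :
    ∏ i ∈ Finset.range k, (1 / (s (i + 1) : ℝ)) =
      1 - ∑ i ∈ Finset.range k, (1 / (s (i + 1) : ℝ)) := by
  induction k with
  | zero => simp
  | succ k ih =>
    rw [Finset.prod_range_succ, Finset.sum_range_succ]
    have h1 : ∏ i ∈ Finset.range k, (1 / (s (i + 1) : ℝ)) = 1 / ((s (k + 1) : ℝ) - 1) := by
      rw [hs k]; simp
    have h2 : (0 : ℝ) < (s (k + 1) : ℝ) - 1 := by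
      rw [hs k]
      push_cast
      have : ∀ i, 0 < s (i + 1) := fun i => by rw [hs i]; omega
      have : (0 : ℝ) < ∏ i ∈ Finset.range k, (s (i + 1) : ℝ) :=
        Finset.prod_pos fun i _ => by exact_mod_cast this i
      linarith
    have h3 : (0 : ℝ) < (s (k + 1) : ℝ) := by linarith
    have h4 : ∑ i ∈ Finset.range k, (1 / (s (i + 1) : ℝ)) = 1 - 1 / ((s (k + 1) : ℝ) - 1) := by
      linarith
    rw [h1, h4]
    field_simp
    ring

theorem sylv_coprime (s : ℕ → ℕ)
    (hs : ∀ k, s (k + 1) = (∏ i ∈ Finset.range k, s (i + 1)) + 1) (i k : ℕ) (hik : i ≠ k) :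
    IsCoprime (s (i + 1) : ℤ) (s (k + 1) : ℤ) := by
  wlog h : i < k generalizing i k
  · exact (this k i hik.symm (by omega)).symm
  obtain ⟨c, hc⟩ := Finset.dvd_prod_of_mem (fun i => s (i + 1)) (Finset.mem_range.2 h)
  refine ⟨-c, 1, ?_⟩
  rw [hs k, hc]
  push_cast
  ring

theorem bary_eq (d : ℕ) (hd : 1 ≤ d) (s : ℕ → ℕ)
    (hs : ∀ k, s (k + 1) = (∏ i ∈ Finset.range k, s (i + 1)) + 1)
    (β : Fin (d + 1) → ℝ) (hβpos : ∀ i, 0 < β i) (hβsum : ∑ i, β i = 1)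
    (hβmono : ∀ i j : Fin (d + 1), i ≤ j → β j ≤ β i)
    (hmin : β (Fin.last d) = 1 / ((s (d + 1) : ℝ) - 1))
    (hu : ∀ (m : ℤ) (n : Fin (d + 1) → ℤ), ∑ i, n i = m → (∀ i, 0 < (m + 1) * β i - n i) →
      ∀ i, (m + 1) * β i - n i = β i) (i : Fin d) :
    β i.castSucc = 1 / (s ((i : ℕ) + 1) : ℝ) := by
  have hspos : ∀ k, (0 : ℝ) < s (k + 1) := fun k => by rw [hs k]; positivity
  set b : ℕ → ℝ := fun n => β (Fin.ofNat (d + 1) n) with hb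
  have hval : ∀ n, n ≤ d → (Fin.ofNat (d + 1) n : Fin (d + 1)).val = n := by
    intro n hn
    simp [Fin.ofNat, Nat.mod_eq_of_lt (Nat.lt_succ_of_le hn)]
  have hinj : ∀ k ≤ d, Set.InjOn (Fin.ofNat (d + 1)) (Finset.range k : Set ℕ) := by
    intro k hk x hx y hy hxy
    simp at hx hy
    have := congrArg Fin.val hxy
    rwa [hval x (by omega), hval y (by omega)] at this
  have hsumb : 1 - ∑ i ∈ Finset.range d, b i = β (Fin.last d) := by
    rw [← hβsum, Fin.sum_univ_castSucc, ← Fin.sum_univ_eq_sum_range]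
    have : ∀ i : Fin d, b i = β i.castSucc := by
      intro i
      simp only [hb]
      congr 1
      ext
      rw [hval _ (by omega)]; simp
    simp_rw [this]; ring
  have hfin := sylvester_extremal (fun n => 1 / (s (n + 1) : ℝ)) b (d - 1)
    (fun i _ => one_div_pos.2 (hspos i)) (fun i _ => hβpos _)
    (fun i hi => hβmono _ _ (by
      rw [Fin.le_def, hval _ (by omega), hval _ (by omega)]; omega))
    (fun k _ => sylv_sum s hs k)
    (fun k hk _ => by
      have := sum_product β hβpos hβsum hu ((Finset.range k).image (Fin.ofNat (d + 1))) (by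
        intro h
        have h1 := Finset.card_image_le (s := Finset.range k) (f := Fin.ofNat (d + 1))
        rw [h] at h1
        simp at h1
        omega)
      rwa [Finset.prod_image (hinj k (by omega)), Finset.sum_image (hinj k (by omega))] at this)
    (by
      rw [Nat.sub_add_cancel hd, hsumb, hmin, hs d]
      simp) i (by omega)
  rw [hfin]
  simp only [hb]
  congr 1
  ext
  rw [hval _ (by omega)]; simp

theorem final_part (d : ℕ) (s : ℕ → ℕ)
    (hs : ∀ k, s (k + 1) = (∏ i ∈ Finset.range k, s (i + 1)) + 1)
    (v : Fin (d + 1) → Fin d → ℤ) (p : Fin d → ℤ)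
    (β : Fin (d + 1) → ℝ) (hβsum : ∑ i, β i = 1)
    (hβbary : ∀ j, (p j : ℝ) = ∑ i, β i * (v i j : ℝ))
    (hβ : ∀ i : Fin d, β i.castSucc = 1 / (s ((i : ℕ) + 1) : ℝ))
    (hlastpos : 0 < β (Fin.last d))
    (hU : ∀ γ : Fin (d + 1) → ℝ, (∀ i, 0 < γ i) → ∑ i, γ i = 1 →
      (∃ q : Fin d → ℤ, ∀ j, (q j : ℝ) = ∑ i, γ i * (v i j : ℝ)) → γ = β)
    (hE : ∀ x : Fin d → ℝ, ∃ γ : Fin (d + 1) → ℝ, ∑ i, γ i = 1 ∧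
      ∀ j, x j = ∑ i, γ i * (v i j : ℝ)) :
    ∃ W C : Matrix (Fin d) (Fin d) ℤ, C * W = 1 ∧
      ∀ (i : Fin d) (j : Fin d), v i.castSucc j - v (Fin.last d) j = s ((i : ℕ) + 1) * W i j := by
  have hspos : ∀ k, (0 : ℝ) < s (k + 1) := fun k => by rw [hs k]; positivity
  -- barycentric combination relative to the last vertex
  have hrel : ∀ (γ : Fin (d + 1) → ℝ) (j : Fin d), ∑ i, γ i = 1 →
      ∑ i, γ i * (v i j : ℝ) = v (Fin.last d) j +
        ∑ i : Fin d, γ i.castSucc * ((v i.castSucc j : ℝ) - v (Fin.last d) j) := by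
    intro γ j hγ
    rw [Fin.sum_univ_castSucc] at hγ ⊢
    have : γ (Fin.last d) = 1 - ∑ i : Fin d, γ i.castSucc := by linarith
    rw [this]
    simp_rw [mul_sub]
    rw [Finset.sum_sub_distrib, ← Finset.sum_mul]
    ring
  have hdvd : ∀ (i : Fin d) (j : Fin d),
      (s ((i : ℕ) + 1) : ℤ) ∣ v i.castSucc j - v (Fin.last d) j := by
    intro i j
    have h1 := hβbary j
    rw [hrel β j hβsum] at h1
    have h2 : (∏ k : Fin d, (s ((k : ℕ) + 1) : ℤ)) * (p j - v (Fin.last d) j) =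
        ∑ i : Fin d, (∏ k ∈ Finset.univ.erase i, (s ((k : ℕ) + 1) : ℤ)) *
          (v i.castSucc j - v (Fin.last d) j) := by
      have h3 : ((∏ k : Fin d, (s ((k : ℕ) + 1) : ℝ)) * (p j - v (Fin.last d) j)) =
        ∑ i : Fin d, (∏ k ∈ Finset.univ.erase i, (s ((k : ℕ) + 1) : ℝ)) *
          (v i.castSucc j - v (Fin.last d) j) := by
        rw [h1, add_sub_cancel_left, Finset.mul_sum]
        apply Finset.sum_congr rfl
        intro i _
        rw [← Finset.mul_prod_erase _ _ (Finset.mem_univ i), hβ i]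
        have := (hspos i).ne'
        field_simp
      exact_mod_cast h3
    have h4 : (s ((i : ℕ) + 1) : ℤ) ∣ (∏ k ∈ Finset.univ.erase i, (s ((k : ℕ) + 1) : ℤ)) *
          (v i.castSucc j - v (Fin.last d) j) := by
      have h5 : (s ((i : ℕ) + 1) : ℤ) ∣ ∑ i : Fin d,
          (∏ k ∈ Finset.univ.erase i, (s ((k : ℕ) + 1) : ℤ)) *
          (v i.castSucc j - v (Fin.last d) j) := by
        rw [← h2]
        exact Dvd.dvd.mul_right (Finset.dvd_prod_of_mem
          (fun k : Fin d => (s ((k : ℕ) + 1) : ℤ)) (Finset.mem_univ i)) _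
      rw [← Finset.add_sum_erase _ _ (Finset.mem_univ i)] at h5
      refine (dvd_add_left (Finset.dvd_sum ?_)).1 h5
      intro l hl
      apply Dvd.dvd.mul_right
      exact Finset.dvd_prod_of_mem (fun k : Fin d => (s ((k : ℕ) + 1) : ℤ))
        (by simp at hl ⊢; exact fun h => hl h.symm)
    refine IsCoprime.dvd_of_dvd_mul_left ?_ h4
    apply IsCoprime.prod_right
    intro k hk
    apply sylv_coprime s hs
    simp at hk
    intro h; exact hk (Fin.ext h.symm)
  choose W hW using hdvd
  have hWr : ∀ (i j : Fin d), (v i.castSucc j : ℝ) - v (Fin.last d) j = s ((i : ℕ) + 1) * (W i j : ℝ) := by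
    intro i j; exact_mod_cast hW i j
  have hgen : ∀ z : Fin d → ℤ, ∃ c : Fin d → ℤ, ∀ j, z j = ∑ i, c i * W i j := by
    intro z
    obtain ⟨γ, hγ1, hγ⟩ := hE (fun j => (z j : ℝ) + v (Fin.last d) j)
    have hz : ∀ j, (z j : ℝ) = ∑ i : Fin d, (γ i.castSucc * s ((i : ℕ) + 1)) * (W i j : ℝ) := by
      intro j
      have := hγ j
      rw [hrel γ j hγ1] at this
      simp_rw [hWr] at this
      simp_rw [mul_assoc]
      linarith
    set l : Fin d → ℝ := fun i => γ i.castSucc * s ((i : ℕ) + 1) with hl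
    set c : Fin d → ℤ := fun i => ⌈l i⌉ - 1 with hc
    have hf0 : ∀ i, 0 < l i - c i := by
      intro i
      have := Int.ceil_lt_add_one (l i)
      simp only [hc]; push_cast; linarith
    have hf1 : ∀ i, l i - c i ≤ 1 := by
      intro i
      have := Int.le_ceil (l i)
      simp only [hc]; push_cast; linarith
    set γ' : Fin (d + 1) → ℝ := Fin.snoc (α := fun _ => ℝ)
      (fun i : Fin d => (l i - c i) / s ((i : ℕ) + 1))
      (1 - ∑ i : Fin d, (l i - c i) / s ((i : ℕ) + 1)) with hγ'
    have hγ'c : ∀ i : Fin d, γ' i.castSucc = (l i - c i) / s ((i : ℕ) + 1) := by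
      intro i; simp [hγ']
    have hγ'l : γ' (Fin.last d) = 1 - ∑ i : Fin d, (l i - c i) / s ((i : ℕ) + 1) := by
      simp [hγ']
    have hγ's : ∑ i, γ' i = 1 := by
      rw [Fin.sum_univ_castSucc, hγ'l]
      simp_rw [hγ'c]
      ring
    have heq := hU γ' (by
      intro i
      refine Fin.lastCases ?_ (fun i => ?_) i
      · rw [hγ'l]
        have h1 : ∑ i : Fin d, (l i - c i) / s ((i : ℕ) + 1) ≤ ∑ i : Fin d, β i.castSucc := by
          apply Finset.sum_le_sum
          intro i _
          rw [hβ]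
          exact div_le_div_of_nonneg_right (hf1 i) (hspos i).le
        rw [Fin.sum_univ_castSucc] at hβsum
        linarith
      · rw [hγ'c]
        exact div_pos (hf0 i) (hspos i)) hγ's
      ⟨fun j => v (Fin.last d) j + z j - ∑ i, c i * W i j, by
        intro j
        rw [hrel γ' j hγ's]
        push_cast
        rw [hz j, add_sub_assoc, ← Finset.sum_sub_distrib]
        congr 1
        apply Finset.sum_congr rfl
        intro i _
        rw [hγ'c, hWr]
        have := (hspos i).ne'
        field_simp
        rfl⟩
    refine ⟨fun i => c i + 1, ?_⟩
    intro j
    have h1 : ∀ i, l i = c i + 1 := by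
      intro i
      have := congrFun heq i.castSucc
      rw [hγ'c, hβ, div_left_inj' (hspos i).ne'] at this
      linarith
    have h2 := hz j
    have h3 : (z j : ℝ) = ∑ i, (c i + 1 : ℝ) * (W i j : ℝ) := by
      rw [h2]
      apply Finset.sum_congr rfl
      intro i _
      rw [← h1 i]
    exact_mod_cast h3
  choose C hC using fun k : Fin d => hgen (fun j => if k = j then 1 else 0)
  refine ⟨Matrix.of W, Matrix.of C, ?_, hW⟩
  ext k j
  rw [Matrix.mul_apply, Matrix.one_apply]
  exact (hC k j).symm

theorem minimal_barycentric_unique_simplex (d : ℕ) (hd : 1 ≤ d)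
    (s : ℕ → ℕ) (hs1 : s 1 = 2)
    (hs : ∀ i, 2 ≤ i → s i = (∏ j ∈ Finset.Icc 1 (i - 1), s j) + 1)
    (v : Fin (d + 1) → Fin d → ℤ)
    (hind : AffineIndependent ℝ (fun i => fun j => (v i j : ℝ)))
    (S : Set (Fin d → ℝ))
    (hS : S = convexHull ℝ (Set.range (fun i => fun j => (v i j : ℝ))))
    (p : Fin d → ℤ) (hp : (fun j => (p j : ℝ)) ∈ interior S)
    (huniq : ∀ q : Fin d → ℤ, (fun j => (q j : ℝ)) ∈ interior S → q = p)
    (β : Fin (d + 1) → ℝ) (hβpos : ∀ i, 0 < β i) (hβsum : ∑ i, β i = 1)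
    (hβmono : ∀ i j : Fin (d + 1), i ≤ j → β j ≤ β i)
    (hβbary : ∀ j, (p j : ℝ) = ∑ i, β i * (v i j : ℝ))
    (hmin : β (Fin.last d) = 1 / ((s (d + 1) : ℝ) - 1)) :
    ∃ (A : Matrix (Fin d) (Fin d) ℤ) (b : Fin d → ℤ), IsUnit A.det ∧
      (fun x : Fin d → ℝ =>
          (A.map (Int.cast : ℤ → ℝ)).mulVec x + fun j => (b j : ℝ)) '' S =
        convexHull ℝ (insert (0 : Fin d → ℝ)
          (Set.range (fun i : Fin d => fun j =>
            if j = i then ((s ((i : ℕ) + 1) : ℝ)) else 0))) := by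
  subst hS
  have hs' := sylv_prod s hs1 hs
  obtain ⟨hU, hE⟩ := simplex_facts d v hind p huniq β hβsum hβbary
  have hu : ∀ (m : ℤ) (n : Fin (d + 1) → ℤ), ∑ i, n i = m →
      (∀ i, 0 < (m + 1) * β i - n i) → ∀ i, (m + 1) * β i - n i = β i := by
    intro m n hn hpos
    have hn' : ∑ i, (n i : ℝ) = m := by exact_mod_cast hn
    have := hU (fun i => (m + 1) * β i - n i) hpos
      (by rw [Finset.sum_sub_distrib, ← Finset.mul_sum, hβsum, hn']; ring)
      ⟨fun j => (m + 1) * p j - ∑ i, n i * v i j, by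
        intro j
        push_cast
        simp_rw [sub_mul]
        rw [Finset.sum_sub_distrib, hβbary j, Finset.mul_sum]
        simp_rw [mul_assoc]⟩
    exact fun i => congrFun this i
  have hβ := bary_eq d hd s hs' β hβpos hβsum hβmono hmin hu
  obtain ⟨W, C, hCW, hW⟩ := final_part d s hs' v p β hβsum hβbary hβ (hβpos _) hU hE
  have hWC : W * C = 1 := mul_eq_one_comm.1 hCW
  refine ⟨C.transpose, fun j => -(C.transpose.mulVec (v (Fin.last d))) j, ?_, ?_⟩
  · rw [Matrix.det_transpose]
    exact IsUnit.of_mul_eq_one W.det (by rw [← Matrix.det_mul, hCW, Matrix.det_one])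
  set b : Fin d → ℤ := fun j => -(C.transpose.mulVec (v (Fin.last d))) j with hb
  let g : (Fin d → ℝ) →ᵃ[ℝ] (Fin d → ℝ) :=
    (Matrix.toLin' (C.transpose.map (Int.cast : ℤ → ℝ))).toAffineMap +
      AffineMap.const ℝ _ (fun j => (b j : ℝ))
  have hg : (fun x : Fin d → ℝ => (C.transpose.map (Int.cast : ℤ → ℝ)).mulVec x +
      fun j => (b j : ℝ)) = g := by
    ext x j
    simp [g]
  have hgv : ∀ (x : Fin d → ℤ) (j : Fin d), g (fun k => (x k : ℝ)) j =
      ((∑ k, (x k - v (Fin.last d) k) * C k j : ℤ) : ℝ) := by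
    intro x j
    rw [← hg]
    simp only [hb, Matrix.mulVec, dotProduct, Matrix.map_apply, Matrix.transpose_apply,
      Pi.add_apply]
    push_cast
    simp_rw [sub_mul]
    rw [Finset.sum_sub_distrib]
    simp_rw [mul_comm (C _ j : ℝ)]
    ring
  rw [hg, AffineMap.image_convexHull]
  congr 1
  have h0 : g (fun j => (v (Fin.last d) j : ℝ)) = 0 := by
    ext j; rw [hgv]; simp
  have h1 : ∀ i : Fin d, g (fun j => (v i.castSucc j : ℝ)) =
      fun j => if j = i then ((s ((i : ℕ) + 1) : ℝ)) else 0 := by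
    intro i
    ext j
    rw [hgv]
    have h2 : (∑ k, (v i.castSucc k - v (Fin.last d) k) * C k j) =
        if j = i then (s ((i : ℕ) + 1) : ℤ) else 0 := by
      simp_rw [hW, mul_assoc]
      rw [← Finset.mul_sum, ← Matrix.mul_apply, hWC, Matrix.one_apply]
      simp [eq_comm]
    rw [h2]
    split_ifs <;> simp
  rw [← Set.range_comp]
  ext y
  constructor
  · rintro ⟨i, rfl⟩
    refine Fin.lastCases ?_ (fun i => ?_) i
    · left; exact h0
    · right; exact ⟨i, (h1 i).symm⟩
  · rintro (rfl | ⟨i, rfl⟩)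
    · exact ⟨Fin.last d, h0⟩
    · exact ⟨i.castSucc, h1 i⟩
end

section
/- Let P ⊆ ℝ^d be a d-dimensional integral polytope such that P' := conv(int(P) ∩ ℤ^d) is nonempty. Then the lattice diameter of P satisfies ld(P) ≤ (ld(P') + 2)(s_d - 1), where (s_i) is the Sylvester sequence. -/
/-- `hasCollin d Q n` says that `Q` contains `n + 1` collinear integer points in
arithmetic progression along a (rational) line, i.e. the lattice diameter of `Q`
is at least `n`. For a convex set `Q` this is equivalent to the existence of a
rational line `g` with `|Q ∩ ℤ^d ∩ g| - 1 ≥ n`. -/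
def hasCollin (d : ℕ) (Q : Set (Fin d → ℝ)) (n : ℕ) : Prop :=
  ∃ p u : Fin d → ℤ, u ≠ 0 ∧ ∀ t : ℕ, t ≤ n →
    (fun j => (p j : ℝ) + (t : ℝ) * (u j : ℝ)) ∈ Q


theorem sylProd (s : ℕ → ℕ) (hs1 : s 1 = 2)
    (hs : ∀ i, 2 ≤ i → s i = (∏ j ∈ Finset.Icc 1 (i - 1), s j) + 1) (r : ℕ) :
    s (r+1) = (∏ i ∈ Finset.range r, s (i+1)) + 1 := by
  have key : ∀ r, ∏ j ∈ Finset.Icc 1 r, s j = ∏ i ∈ Finset.range r, s (i+1) := by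
    intro r
    rw [Finset.range_eq_Ico, Finset.prod_Ico_add' s 0 r 1]
    rfl
  rcases Nat.eq_zero_or_pos r with rfl | h
  · simp [hs1]
  · rw [hs (r+1) (by omega), ← key]; simp

/-- Abel summation, nonnegative tail sums against a nonnegative monotone weight. -/
theorem abelTail (r : ℕ) (D w : ℕ → ℝ) (hw0 : ∀ i < r, 0 ≤ w i)
    (hw : ∀ i, i + 1 < r → w i ≤ w (i+1))
    (hT : ∀ j < r, 0 ≤ ∑ i ∈ Finset.Ico j r, D i) :
    0 ≤ ∑ i ∈ Finset.range r, D i * w i := by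
  have key : ∀ k, k < r → w (r - 1 - k) * ∑ i ∈ Finset.Ico (r-1-k) r, D i
      ≤ ∑ i ∈ Finset.Ico (r-1-k) r, D i * w i := by
    intro k
    induction k with
    | zero =>
      intro h
      have : Finset.Ico (r-1-0) r = {r-1} := by
        ext x; simp; omega
      rw [this]; simp [mul_comm]
    | succ k ih =>
      intro h
      have ih := ih (by omega)
      obtain ⟨j, hj⟩ : ∃ j, j = r - 1 - (k+1) := ⟨_, rfl⟩
      have hj' : r - 1 - k = j + 1 := by omega
      rw [hj'] at ih
      have hjr : j < r := by omega
      rw [← hj, Finset.sum_eq_sum_Ico_succ_bot hjr D,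
        Finset.sum_eq_sum_Ico_succ_bot hjr (fun i => D i * w i)]
      have h1 := hw j (by omega)
      have h2 := hT (j+1) (by omega)
      nlinarith
  rcases Nat.eq_zero_or_pos r with rfl | h
  · simp
  · have := key (r-1) (by omega)
    rw [Nat.sub_self] at this
    rw [Finset.range_eq_Ico]
    exact le_trans (mul_nonneg (hw0 0 h) (hT 0 h)) this

theorem elemBound (S : ℕ → ℕ) (hS : ∀ r, S r = (∏ i ∈ Finset.range r, S i) + 1)
    (r : ℕ) (b : ℕ → ℝ) (hb : ∀ i < r, 0 < b i)
    (hanti : ∀ i, i + 1 < r → b (i+1) ≤ b i)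
    (hps : ∀ j ≤ r, ∑ i ∈ Finset.range j, b i + ∏ i ∈ Finset.range j, b i ≤ 1) :
    ∑ i ∈ Finset.range r, b i ≤ 1 - 1 / ∏ i ∈ Finset.range r, (S i : ℝ) := by
  have hSpos : ∀ i, (0:ℝ) < S i := by
    intro i; rw [hS i]; push_cast; positivity
  have hsum : ∀ r, ∑ i ∈ Finset.range r, 1 / (S i : ℝ) = 1 - 1 / ∏ i ∈ Finset.range r, (S i : ℝ) := by
    intro r
    induction r with
    | zero => simp
    | succ r ih =>
      rw [Finset.sum_range_succ, ih, Finset.prod_range_succ]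
      have h1 : (S r : ℝ) = (∏ i ∈ Finset.range r, (S i : ℝ)) + 1 := by
        have := hS r
        exact_mod_cast this
      have h2 : 0 < ∏ i ∈ Finset.range r, (S i : ℝ) := Finset.prod_pos fun i _ => hSpos i
      have h3 := hSpos r
      field_simp
      rw [h1]; ring
  induction r using Nat.strong_induction_on with
  | _ r ih =>
  by_contra hcon
  push Not at hcon
  have htail : ∀ j < r, 0 ≤ ∑ i ∈ Finset.Ico j r, (b i - 1 / (S i : ℝ)) := by
    intro j hj
    have h1 := ih j hj (fun i hi => hb i (by omega)) (fun i hi => hanti i (by omega))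
      (fun k hk => hps k (by omega))
    rw [Finset.sum_Ico_eq_sub _ hj.le, Finset.sum_sub_distrib, Finset.sum_sub_distrib, hsum, hsum]
    linarith
  have habel := abelTail r (fun i => b i - 1 / (S i : ℝ)) (fun i => 1 / b i)
    (fun i hi => (one_div_pos.2 (hb i hi)).le)
    (fun i hi => one_div_le_one_div_of_le (hb _ hi) (hanti i hi)) htail
  have hlog : ∑ i ∈ Finset.range r, (b i - 1 / (S i : ℝ)) * (1 / b i) ≤
      ∑ i ∈ Finset.range r, Real.log (b i * S i) := by
    apply Finset.sum_le_sum
    intro i hi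
    have hbi := hb i (Finset.mem_range.1 hi)
    have := Real.one_sub_inv_le_log_of_pos (mul_pos hbi (hSpos i))
    refine le_trans (le_of_eq ?_) this
    have := hSpos i
    field_simp
  have h3 : ∏ i ∈ Finset.range r, (b i * S i) < 1 := by
    rw [Finset.prod_mul_distrib]
    have h2 : 0 < ∏ i ∈ Finset.range r, (S i : ℝ) := Finset.prod_pos fun i _ => hSpos i
    rw [← lt_div_iff₀ h2]
    linarith [hps r le_rfl]
  have h4 : 0 < ∏ i ∈ Finset.range r, (b i * S i) :=
    Finset.prod_pos fun i hi => mul_pos (hb i (Finset.mem_range.1 hi)) (hSpos i)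
  rw [← Real.log_prod (fun i hi => (mul_pos (hb i (Finset.mem_range.1 hi)) (hSpos i)).ne')] at hlog
  linarith [Real.log_neg h4 h3]

/-- subset version -/
theorem elemBoundFinset {α : Type*} [DecidableEq α] (S : ℕ → ℕ) (hS : ∀ r, S r = (∏ i ∈ Finset.range r, S i) + 1)
    (T : Finset α) (β : α → ℝ) (r : ℕ) (hr : T.card = r + 1) (hβ : ∀ t ∈ T, 0 < β t)
    (h1 : ∑ t ∈ T, β t = 1)
    (hI : ∀ J ⊆ T, J ≠ T → ∏ t ∈ J, β t ≤ 1 - ∑ t ∈ J, β t) :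
    ∀ t ∈ T, 1 / (∏ i ∈ Finset.range r, (S i : ℝ)) ≤ β t := by
  classical
  let e0 : Fin (r+1) ≃ T := (T.equivFinOfCardEq hr).symm
  let σ := Tuple.sort (fun i => - β (e0 i))
  have hmono := Tuple.monotone_sort (fun i => - β (e0 i))
  let e : Fin (r+1) ≃ T := σ.trans e0
  have hanti : ∀ i j : Fin (r+1), i ≤ j → β (e j) ≤ β (e i) := by
    intro i j hij
    have := hmono hij
    simpa [e, σ] using this
  let g : ℕ → α := fun i => e (Fin.ofNat (r+1) i)
  have hgT : ∀ i, g i ∈ T := fun i => (e _).2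
  have hginj : ∀ i < r+1, ∀ j < r+1, g i = g j → i = j := by
    intro i hi j hj h
    have := e.injective (Subtype.ext h)
    have := congrArg Fin.val this
    simpa [Nat.mod_eq_of_lt hi, Nat.mod_eq_of_lt hj] using this
  have himg : (Finset.range (r+1)).image g = T := by
    apply Finset.eq_of_subset_of_card_le
    · intro x hx
      obtain ⟨i, -, rfl⟩ := Finset.mem_image.1 hx
      exact hgT i
    · rw [Finset.card_image_of_injOn, Finset.card_range, hr]
      intro i hi j hj h
      exact hginj i (by simpa using hi) j (by simpa using hj) h
  have hganti : ∀ i j, i ≤ j → j < r+1 → β (g j) ≤ β (g i) := by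
    intro i j hij hj
    apply hanti
    rw [Fin.le_def]
    simp [Nat.mod_eq_of_lt hj, Nat.mod_eq_of_lt (lt_of_le_of_lt hij hj)]
    exact hij
  have hinjOn : ∀ j ≤ r+1, Set.InjOn g (Finset.range j) := by
    intro j hj i hi k hk h
    simp at hi hk
    exact hginj i (by omega) k (by omega) h
  have hb := elemBound S hS r (fun i => β (g i)) (fun i _ => hβ _ (hgT i))
    (fun i hi => hganti i (i+1) (by omega) (by omega)) (by
      intro j hj
      have := hI ((Finset.range j).image g) (by
        intro x hx
        obtain ⟨i, -, rfl⟩ := Finset.mem_image.1 hx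
        exact hgT i) (by
        intro h
        have := congrArg Finset.card h
        rw [Finset.card_image_of_injOn (hinjOn j (by omega)), hr] at this
        simp at this; omega)
      rw [Finset.prod_image (hinjOn j (by omega)), Finset.sum_image (hinjOn j (by omega))] at this
      linarith)
  have htot : ∑ i ∈ Finset.range (r+1), β (g i) = 1 := by
    rw [← h1, ← himg, Finset.sum_image (hinjOn _ le_rfl)]
  rw [Finset.sum_range_succ] at htot
  intro t ht
  rw [← himg] at ht
  obtain ⟨i, hi, rfl⟩ := Finset.mem_image.1 ht
  have := hganti i r (by simp at hi; omega) (by omega)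
  linarith

open MeasureTheory in
theorem minkForm {ι : Type} [Fintype ι] [DecidableEq ι] (β : ι → ℝ) (hβ : ∀ i, 0 < β i)
    (hs : 0 < 1 - ∑ i, β i) (hp : 1 - ∑ i, β i < ∏ i, β i) :
    ∃ a : ι → ℤ, a ≠ 0 ∧ ∀ i, |(∑ k, (a k : ℝ)) * β i - a i| < β i := by
  classical
  let M : Matrix ι ι ℝ := 1 - Matrix.replicateCol Unit β * Matrix.replicateRow Unit (fun _ => (1:ℝ))
  have hdet : M.det = 1 - ∑ i, β i := by
    have := Matrix.det_one_add_replicateCol_mul_replicateRow (ι := Unit) (-β) (fun _ : ι => (1:ℝ))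
    have h2 : M = 1 + Matrix.replicateCol Unit (-β) * Matrix.replicateRow Unit (fun _ => (1:ℝ)) := by
      ext i j; simp [M, Matrix.mul_apply, sub_eq_add_neg]
    rw [h2, this]
    simp [dotProduct, sub_eq_add_neg]
  let f : (ι → ℝ) →ₗ[ℝ] (ι → ℝ) := Matrix.toLin' M
  have hfdet : LinearMap.det f = 1 - ∑ i, β i := by
    simp only [f, LinearMap.det_toLin', hdet]
  have hf : ∀ x i, f x i = x i - (∑ k, x k) * β i := by
    intro x i
    simp only [f, M, Matrix.toLin'_apply, Matrix.sub_mulVec, Matrix.one_mulVec, Pi.sub_apply]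
    congr 1
    simp [Matrix.mulVec, dotProduct, Matrix.mul_apply, ← Finset.mul_sum, mul_comm]
  let box : Set (ι → ℝ) := Set.pi Set.univ fun i => Set.Ioo (- β i) (β i)
  have hvolbox : volume box = ENNReal.ofReal (∏ i, (2 * β i)) := by
    rw [Real.volume_pi_Ioo, ENNReal.ofReal_prod_of_nonneg]
    · congr 1; ext i; congr 1; ring
    · intro i _; linarith [hβ i]
  have hvol : volume (f ⁻¹' box) = ENNReal.ofReal (1 - ∑ i, β i)⁻¹ * ENNReal.ofReal (∏ i, (2 * β i)) := by
    rw [Measure.addHaar_preimage_linearMap _ (by rw [hfdet]; exact hs.ne'), hfdet, hvolbox,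
      abs_of_pos (inv_pos.2 hs)]
  let b := Pi.basisFun ℝ ι
  let L : AddSubgroup (ι → ℝ) := (Submodule.span ℤ (Set.range b)).toAddSubgroup
  have : Countable L := by
    have : Countable (Submodule.span ℤ (Set.range b)) := inferInstance
    exact this
  have hfd := ZSpan.isAddFundamentalDomain b (volume : Measure (ι → ℝ))
  have hfd1 : volume (ZSpan.fundamentalDomain b) = 1 := by
    simp [b, ZSpan.fundamentalDomain_pi_basisFun, Real.volume_pi_Ico]
  obtain ⟨x, hx0, hx⟩ := exists_ne_zero_mem_lattice_of_measure_mul_two_pow_lt_measure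
    (L := L) (s := f ⁻¹' box) hfd (by
      intro x hx i hi
      have := hx i hi
      rw [map_neg]
      simp only [Set.mem_Ioo, Pi.neg_apply] at this ⊢
      constructor <;> linarith) (by
      apply Convex.linear_preimage
      exact convex_pi fun i _ => convex_Ioo _ _) (by
      rw [hfd1, hvol, ← ENNReal.ofReal_mul (inv_pos.2 hs).le, one_mul, Module.finrank_fintype_fun_eq_card,
        Finset.prod_mul_distrib]
      have : (2:ENNReal) ^ Fintype.card ι = ENNReal.ofReal (2 ^ Fintype.card ι) := by
        rw [ENNReal.ofReal_pow (by norm_num)]; simp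
      rw [this, ENNReal.ofReal_lt_ofReal_iff_of_nonneg (by positivity)]
      simp only [Finset.prod_const, Finset.card_univ]
      rw [mul_comm, mul_assoc]
      refine lt_mul_of_one_lt_right (by positivity) ?_
      rw [← div_eq_mul_inv, one_lt_div hs]
      exact hp)
  have hxL : (x : ι → ℝ) ∈ Submodule.span ℤ (Set.range b) := x.2
  rw [Module.Basis.mem_span_iff_repr_mem] at hxL
  choose a ha using hxL
  have ha' : ∀ i, (a i : ℝ) = (x : ι → ℝ) i := by
    intro i; simpa [b] using ha i
  refine ⟨a, ?_, ?_⟩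
  · rintro rfl
    apply hx0
    ext i
    simpa using (ha' i).symm
  · intro i
    have := hx i trivial
    rw [hf] at this
    simp only [ha']
    rw [abs_lt]
    constructor <;> linarith [this.1, this.2]

/-- A lattice simplex candidate `T` with vertex `x0`, and positive weights `β` giving a lattice
point in `I`. -/
structure Cand {W : Type*} [AddCommGroup W] [Module ℝ W] (Λ : AddSubgroup W) (Q I : Set W)
    (x0 : W) (T : Finset W) (β : W → ℝ) : Prop where
  sub : ∀ t ∈ T, t ∈ Q
  lat : ∀ t ∈ T, t ∈ Λ
  mem : x0 ∈ T
  pos : ∀ t ∈ T, 0 < β t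
  sum : ∑ t ∈ T, β t = 1
  inI : ∑ t ∈ T, β t • t ∈ I
  inL : ∑ t ∈ T, β t • t ∈ Λ

/-- Affine independence of a finset. -/
def AI {W : Type*} [AddCommGroup W] [Module ℝ W] (T : Finset W) : Prop :=
  ∀ c : W → ℝ, ∑ t ∈ T, c t = 0 → ∑ t ∈ T, c t • t = 0 → ∀ t ∈ T, c t = 0

theorem cand_carath {W : Type*} [AddCommGroup W] [Module ℝ W] (Λ : AddSubgroup W) (Q I : Set W)
    (x0 : W) (n : ℕ) : ∀ (T : Finset W) (β : W → ℝ), T.card ≤ n → Cand Λ Q I x0 T β →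
    ∃ T' β', T' ⊆ T ∧ Cand Λ Q I x0 T' β' ∧ AI T' := by
  classical
  induction n with
  | zero =>
    intro T β hT h
    have : T = ∅ := by simpa using hT
    have := h.mem
    simp_all
  | succ n ih =>
    intro T β hT h
    by_cases hAI : AI T
    · exact ⟨T, β, subset_rfl, h, hAI⟩
    have hex : ∃ c : W → ℝ, ∑ t ∈ T, c t = 0 ∧ ∑ t ∈ T, c t • t = 0 ∧ (∃ t ∈ T, c t ≠ 0) ∧ 0 ≤ c x0 := by
      unfold AI at hAI
      push Not at hAI
      obtain ⟨c, h1, h2, t, ht, h3⟩ := hAI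
      rcases le_total 0 (c x0) with h0 | h0
      · exact ⟨c, h1, h2, ⟨t, ht, h3⟩, h0⟩
      · exact ⟨fun t => - c t, by simp [h1], by simp [h2], ⟨t, ht, by simpa using h3⟩, by simpa using h0⟩
    obtain ⟨c, h1, h2, ⟨t, ht, h3⟩, h0⟩ := hex
    have hneg : ∃ t ∈ T, c t < 0 := by
      by_contra hcon
      push Not at hcon
      exact h3 ((Finset.sum_eq_zero_iff_of_nonneg hcon).1 h1 t ht)
    obtain ⟨v, hv, hmin⟩ := Finset.exists_min_image (T.filter (fun t => c t < 0))
      (fun t => β t / (- c t)) (by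
        obtain ⟨t, ht, h⟩ := hneg
        exact ⟨t, Finset.mem_filter.2 ⟨ht, h⟩⟩)
    rw [Finset.mem_filter] at hv
    obtain ⟨hvT, hvneg⟩ := hv
    set ε := β v / (- c v) with hε
    have hεpos : 0 < ε := div_pos (h.pos v hvT) (by linarith)
    have hnn : ∀ t ∈ T, 0 ≤ β t + ε * c t := by
      intro t ht
      by_cases hc : c t < 0
      · have := hmin t (Finset.mem_filter.2 ⟨ht, hc⟩)
        rw [le_div_iff₀ (by linarith)] at this
        linarith
      · push Not at hc
        have := h.pos t ht
        positivity
    have hv0 : β v + ε * c v = 0 := by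
      rw [hε]; have : c v ≠ 0 := hvneg.ne
      field_simp; ring
    let T' := T.filter (fun t => 0 < β t + ε * c t)
    have hout : ∀ t ∈ T, t ∉ T' → β t + ε * c t = 0 := by
      intro t ht ht'
      have := hnn t ht
      by_contra hne
      exact ht' (Finset.mem_filter.2 ⟨ht, lt_of_le_of_ne this (Ne.symm hne)⟩)
    have hs1 : ∑ t ∈ T', (β t + ε * c t) = 1 := by
      rw [Finset.sum_subset (Finset.filter_subset _ T) hout, Finset.sum_add_distrib, ← Finset.mul_sum, h1,
        h.sum]; simp
    have hs2 : ∑ t ∈ T', (β t + ε * c t) • t = ∑ t ∈ T, β t • t := by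
      rw [Finset.sum_subset (Finset.filter_subset _ T) (fun t ht ht' => by rw [hout t ht ht', zero_smul])]
      simp only [add_smul, mul_smul, Finset.sum_add_distrib, ← Finset.smul_sum, h2, smul_zero, add_zero]
    have hsub : T' ⊆ T := Finset.filter_subset _ T
    have hcard : T'.card ≤ n := by
      have : T'.card < T.card := Finset.card_lt_card ⟨hsub, fun hh => by
        have := (Finset.mem_filter.1 (hh hvT)).2
        linarith⟩
      omega
    obtain ⟨T'', β'', h5, h6, h7⟩ := ih T' (fun t => β t + ε * c t) hcard
      { sub := fun t ht => h.sub t (hsub ht)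
        lat := fun t ht => h.lat t (hsub ht)
        mem := Finset.mem_filter.2 ⟨h.mem, by have := h.pos x0 h.mem; positivity⟩
        pos := fun t ht => (Finset.mem_filter.1 ht).2
        sum := hs1
        inI := by rw [hs2]; exact h.inI
        inL := by rw [hs2]; exact h.inL }
    exact ⟨T'', β'', h5.trans hsub, h6, h7⟩

theorem AI.eq {W : Type*} [AddCommGroup W] [Module ℝ W] {T : Finset W} (h : AI T) {c c' : W → ℝ}
    (h1 : ∑ t ∈ T, c t = ∑ t ∈ T, c' t) (h2 : ∑ t ∈ T, c t • t = ∑ t ∈ T, c' t • t) :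
    ∀ t ∈ T, c t = c' t := by
  intro t ht
  have := h (fun t => c t - c' t) (by simp [h1]) (by simp [sub_smul, h2]) t ht
  simpa [sub_eq_zero] using this

/-- One step of the shrinking procedure. -/
theorem cand_shrink {W : Type*} [AddCommGroup W] [Module ℝ W] (Λ : AddSubgroup W) (Q I : Set W)
    (hQ : Convex ℝ Q) (hF : (Q ∩ Λ).Finite)
    (x0 : W) (T : Finset W) (β β' : W → ℝ) (h : Cand Λ Q I x0 T β) (h' : Cand Λ Q I x0 T β')
    (hAI : AI T) (hmax : β' x0 ≤ β x0) (hne : ∃ t ∈ T, β' t ≠ β t) :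
    ∃ T' γ, Cand Λ Q I x0 T' γ ∧
      (Q ∩ Λ ∩ convexHull ℝ (T' : Set W)).ncard < (Q ∩ Λ ∩ convexHull ℝ (T : Set W)).ncard := by
  classical
  obtain ⟨v, hv, hmin⟩ := Finset.exists_min_image T (fun t => β t / β' t) ⟨x0, h.mem⟩
  set ρ := β v / β' v with hρ
  have hρpos : 0 < ρ := div_pos (h.pos v hv) (h'.pos v hv)
  have hnn : ∀ t ∈ T, 0 ≤ β t - ρ * β' t := by
    intro t ht
    have := hmin t ht
    rw [le_div_iff₀ (h'.pos t ht)] at this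
    linarith
  have hv0 : β v - ρ * β' v = 0 := by
    have := h'.pos v hv
    rw [hρ]; field_simp; ring
  have hρ1 : ρ < 1 := by
    by_contra hcon
    push Not at hcon
    obtain ⟨t, ht, hne⟩ := hne
    have hle : ∀ t ∈ T, 0 ≤ β t - β' t := by
      intro t ht
      have := hnn t ht
      have := h'.pos t ht
      nlinarith
    have := (Finset.sum_eq_zero_iff_of_nonneg hle).1 (by rw [Finset.sum_sub_distrib, h.sum, h'.sum, sub_self]) t ht
    exact hne (by linarith)
  have hx0 : 0 < β x0 - ρ * β' x0 := by
    have := h'.pos x0 h.mem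
    nlinarith
  set y' := ∑ t ∈ T, β' t • t with hy'
  let A := T.filter (fun t => 0 < β t - ρ * β' t)
  have hAT : A ⊆ T := Finset.filter_subset _ _
  have hvA : v ∉ A := by
    intro hh
    have := (Finset.mem_filter.1 hh).2
    linarith
  have hxA : x0 ∈ A := Finset.mem_filter.2 ⟨h.mem, hx0⟩
  have hvx : v ≠ x0 := by rintro rfl; exact hvA hxA
  have hout : ∀ t ∈ T, t ∉ A → β t - ρ * β' t = 0 := by
    intro t ht ht'
    have := hnn t ht
    by_contra hne
    exact ht' (Finset.mem_filter.2 ⟨ht, lt_of_le_of_ne this (Ne.symm hne)⟩)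
  have hcT : ∀ p ∈ convexHull ℝ (T : Set W), p ∈ Q := fun p hp =>
    convexHull_min (fun t ht => h.sub t ht) hQ hp
  have hy'T : y' ∈ convexHull ℝ (T : Set W) :=
    Finset.mem_convexHull'.2 ⟨β', fun t ht => (h'.pos t ht).le, h'.sum, rfl⟩
  let γ : W → ℝ := fun t => (if t ∈ A then β t - ρ * β' t else 0) + (if t = y' then ρ else 0)
  have hs1 : ∑ t ∈ insert y' A, γ t = 1 := by
    simp only [γ, Finset.sum_add_distrib]
    rw [Finset.sum_ite_eq' (insert y' A) y', if_pos (Finset.mem_insert_self _ _), Finset.sum_ite_mem,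
      Finset.inter_eq_right.2 (Finset.subset_insert _ _), Finset.sum_subset hAT hout,
      Finset.sum_sub_distrib, ← Finset.mul_sum, h.sum, h'.sum]
    ring
  have hs2 : ∑ t ∈ insert y' A, γ t • t = ∑ t ∈ T, β t • t := by
    simp only [γ, add_smul, ite_smul, zero_smul, Finset.sum_add_distrib]
    rw [Finset.sum_ite_eq' (insert y' A) y', if_pos (Finset.mem_insert_self _ _), Finset.sum_ite_mem,
      Finset.inter_eq_right.2 (Finset.subset_insert _ _),
      Finset.sum_subset hAT (fun t ht ht' => by rw [hout t ht ht', zero_smul])]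
    simp only [sub_smul, mul_smul, Finset.sum_sub_distrib, ← Finset.smul_sum]
    rw [← hy']
    abel
  refine ⟨insert y' A, γ, ?_, ?_⟩
  · exact
    { sub := by
        intro t ht
        rcases Finset.mem_insert.1 ht with rfl | ht
        · exact hcT _ hy'T
        · exact h.sub t (hAT ht)
      lat := by
        intro t ht
        rcases Finset.mem_insert.1 ht with rfl | ht
        · exact h'.inL
        · exact h.lat t (hAT ht)
      mem := Finset.mem_insert_of_mem hxA
      pos := by
        intro t ht
        have hA : ∀ t ∈ A, 0 < β t - ρ * β' t := fun t ht => (Finset.mem_filter.1 ht).2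
        by_cases h1 : t ∈ A
        · have := hA t h1
          simp only [γ, h1, if_true]
          split_ifs <;> linarith
        · have h2 : t = y' := by
            rcases Finset.mem_insert.1 ht with h2 | h2
            · exact h2
            · exact absurd h2 h1
          simp only [γ, h2, if_true]
          split_ifs with h3
          · exact absurd (h2 ▸ h3) h1
          · linarith
      sum := hs1
      inI := by rw [hs2]; exact h.inI
      inL := by rw [hs2]; exact h.inL }
  · apply Set.ncard_lt_ncard _ (hF.subset Set.inter_subset_left)
    have hsub : convexHull ℝ ((insert y' A : Finset W) : Set W) ⊆ convexHull ℝ (T : Set W) := by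
      apply convexHull_min _ (convex_convexHull ℝ _)
      intro t ht
      rcases Finset.mem_insert.1 (Finset.mem_coe.1 ht) with rfl | ht
      · exact hy'T
      · exact subset_convexHull ℝ _ (hAT ht)
    have hvn : v ∉ convexHull ℝ ((insert y' A : Finset W) : Set W) := by
      let H : Set W := {p | ∃ c : W → ℝ, ∑ t ∈ T, c t = 1 ∧ ∑ t ∈ T, c t • t = p ∧ c v < 1}
      have hH : Convex ℝ H := by
        rintro p ⟨c, h1, h2, h3⟩ q ⟨c', h1', h2', h3'⟩ a b ha hb hab
        refine ⟨fun t => a * c t + b * c' t, ?_, ?_, ?_⟩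
        · rw [Finset.sum_add_distrib, ← Finset.mul_sum, ← Finset.mul_sum, h1, h1']; linarith
        · simp only [add_smul, mul_smul, Finset.sum_add_distrib, ← Finset.smul_sum, h2, h2']
        · rcases ha.eq_or_lt with rfl | ha
          · have : b = 1 := by linarith
            subst this; simpa using h3'
          · have : a * c v < a := by nlinarith
            have : b * c' v ≤ b := by nlinarith
            show a * c v + b * c' v < 1
            linarith
      have hδ : ∀ w ∈ T, ∑ t ∈ T, (if t = w then (1:ℝ) else 0) = 1 ∧
          ∑ t ∈ T, (if t = w then (1:ℝ) else 0) • t = w := by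
        intro w hw
        constructor
        · rw [Finset.sum_ite_eq' T w, if_pos hw]
        · simp only [ite_smul, zero_smul, one_smul]
          rw [Finset.sum_ite_eq' T w, if_pos hw]
      have hsubH : ((insert y' A : Finset W) : Set W) ⊆ H := by
        intro t ht
        rcases Finset.mem_insert.1 (Finset.mem_coe.1 ht) with rfl | ht
        · refine ⟨β', h'.sum, rfl, ?_⟩
          have h1 : β' v + β' x0 ≤ ∑ t ∈ T, β' t := by
            rw [← Finset.sum_pair hvx]
            apply Finset.sum_le_sum_of_subset_of_nonneg
            · intro t ht
              simp at ht
              rcases ht with rfl | rfl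
              · exact hv
              · exact h.mem
            · intro t ht _
              exact (h'.pos t ht).le
          have := h'.pos x0 h.mem
          rw [h'.sum] at h1
          linarith
        · refine ⟨_, (hδ t (hAT ht)).1, (hδ t (hAT ht)).2, ?_⟩
          have : v ≠ t := by rintro rfl; exact hvA ht
          simp [this]
      intro hcon
      obtain ⟨c, h1, h2, h3⟩ := convexHull_min hsubH hH hcon
      have := hAI.eq (h1.trans (hδ v hv).1.symm) (h2.trans (hδ v hv).2.symm) v hv
      simp at this
      linarith
    refine ⟨Set.inter_subset_inter_right _ hsub, fun hcon => hvn ?_⟩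
    exact (hcon ⟨⟨h.sub v hv, h.lat v hv⟩, subset_convexHull ℝ _ hv⟩).2

/-- Existence of a lattice simplex with vertex `x0` and unique relatively interior lattice point. -/
theorem cand_unique {W : Type*} [AddCommGroup W] [Module ℝ W] (Λ : AddSubgroup W) (Q I : Set W)
    (hQ : Convex ℝ Q) (hF : (Q ∩ Λ).Finite)
    (hI : ∀ a ∈ I, ∀ b ∈ Q, ∀ t : ℝ, 0 < t → t ≤ 1 → t • a + (1 - t) • b ∈ I)
    (x0 : W) (T0 : Finset W) (β0 : W → ℝ) (h0 : Cand Λ Q I x0 T0 β0) :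
    ∃ T β, Cand Λ Q I x0 T β ∧ AI T ∧ ∀ β' : W → ℝ, (∀ t ∈ T, 0 < β' t) → ∑ t ∈ T, β' t = 1 →
      ∑ t ∈ T, β' t • t ∈ Λ → ∀ t ∈ T, β' t = β t := by
  classical
  let N : Finset W → ℕ := fun T => (Q ∩ Λ ∩ convexHull ℝ (T : Set W)).ncard
  have hNmono : ∀ T T' : Finset W, T' ⊆ T → N T' ≤ N T := by
    intro T T' h
    apply Set.ncard_le_ncard _ (hF.subset Set.inter_subset_left)
    exact Set.inter_subset_inter_right _ (convexHull_mono (by exact_mod_cast h))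
  have hex : ∃ n, ∃ T β, Cand Λ Q I x0 T β ∧ N T = n := ⟨_, T0, β0, h0, rfl⟩
  obtain ⟨T1, β1, h1, hN1⟩ := Nat.find_spec hex
  have hmin : ∀ T β, Cand Λ Q I x0 T β → N T1 ≤ N T := by
    intro T β h
    rw [hN1]
    exact Nat.find_min' hex ⟨T, β, h, rfl⟩
  obtain ⟨T, β2, hT, h2, hAI⟩ := cand_carath Λ Q I x0 _ T1 β1 le_rfl h1
  have hTmin : ∀ T' β, Cand Λ Q I x0 T' β → N T ≤ N T' := fun T' β h =>
    (hNmono _ _ hT).trans (hmin T' β h)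
  let Y : Set W := {y | ∃ β, Cand Λ Q I x0 T β ∧ ∑ t ∈ T, β t • t = y}
  have hYfin : Y.Finite := by
    apply hF.subset
    rintro y ⟨β, h, rfl⟩
    refine ⟨?_, h.inL⟩
    exact hQ.sum_mem (fun t ht => (h.pos t ht).le) h.sum h.sub
  choose! B hB1 hB2 using fun y (hy : y ∈ Y) => hy
  obtain ⟨y, hyY, hymax⟩ := Set.exists_max_image Y (fun y => B y x0) hYfin ⟨_, β2, h2, rfl⟩
  refine ⟨T, B y, hB1 y hyY, hAI, ?_⟩
  intro β' hpos hsum hlat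
  by_contra hcon
  push Not at hcon
  have hc := hB1 y hyY
  have hc' : Cand Λ Q I x0 T β' := by
    refine ⟨hc.sub, hc.lat, hc.mem, hpos, hsum, ?_, hlat⟩
    obtain ⟨v, hv, hvmin⟩ := Finset.exists_min_image T β' ⟨x0, hc.mem⟩
    have hvpos := hpos v hv
    set ε := min (β' v) (1/2) with hε
    have hε0 : 0 < ε := lt_min hvpos (by norm_num)
    have hε1 : ε ≤ 1/2 := min_le_right _ _
    have hεv : ε ≤ β' v := min_le_left _ _
    have hq : ∑ t ∈ T, ((β' t - ε * B y t) / (1 - ε)) • t ∈ Q := by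
      apply hQ.sum_mem _ _ hc.sub
      · intro t ht
        apply div_nonneg _ (by linarith)
        have h1 := hvmin t ht
        have h2 : B y t ≤ 1 := by
          rw [← hc.sum]
          exact Finset.single_le_sum (f := B y) (fun t ht => (hc.pos t ht).le) ht
        nlinarith
      · rw [← Finset.sum_div, Finset.sum_sub_distrib, ← Finset.mul_sum, hsum, hc.sum, mul_one,
          div_self (by linarith)]
    have := hI _ hc.inI _ hq ε hε0 (by linarith)
    convert this using 1
    rw [Finset.smul_sum, Finset.smul_sum, ← Finset.sum_add_distrib]
    apply Finset.sum_congr rfl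
    intro t _
    rw [smul_smul, smul_smul, ← add_smul]
    congr 1
    have : 1 - ε ≠ 0 := by linarith
    field_simp
    ring
  have hle : β' x0 ≤ B y x0 := by
    have hy' : (∑ t ∈ T, β' t • t) ∈ Y := ⟨β', hc', rfl⟩
    have h3 := hymax _ hy'
    have h4 := hAI.eq ((hB1 _ hy').sum.trans hsum.symm) (hB2 _ hy') x0 hc.mem
    linarith
  obtain ⟨T', γ, h5, h6⟩ := cand_shrink Λ Q I hQ hF x0 T (B y) β' hc hc' hAI hle hcon
  exact absurd (hTmin T' γ h5) (not_le.2 h6)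

/-- Product-sum inequality. -/
theorem prodSum {W : Type} [AddCommGroup W] [Module ℝ W] (Λ : AddSubgroup W)
    (T : Finset W) (β : W → ℝ) (hlat : ∀ t ∈ T, t ∈ Λ) (hpos : ∀ t ∈ T, 0 < β t)
    (hsum : ∑ t ∈ T, β t = 1) (hL : ∑ t ∈ T, β t • t ∈ Λ)
    (huniq : ∀ β' : W → ℝ, (∀ t ∈ T, 0 < β' t) → ∑ t ∈ T, β' t = 1 →
      ∑ t ∈ T, β' t • t ∈ Λ → ∀ t ∈ T, β' t = β t)
    (J : Finset W) (hJ : J ⊆ T) (hJT : J ≠ T) : ∏ t ∈ J, β t ≤ 1 - ∑ t ∈ J, β t := by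
  classical
  by_contra hcon
  push Not at hcon
  obtain ⟨j, hjT, hjJ⟩ : ∃ j ∈ T, j ∉ J := by
    by_contra hh
    push Not at hh
    exact hJT (hJ.antisymm hh)
  have hlt : ∑ t ∈ J, β t < 1 := by
    rw [← hsum]
    exact Finset.sum_lt_sum_of_subset hJ hjT hjJ (hpos j hjT) (fun t ht _ => (hpos t ht).le)
  obtain ⟨a0, ha0, hab0⟩ := minkForm (fun i : J => β i) (fun i => hpos _ (hJ i.2))
    (by rw [Finset.sum_coe_sort J β]; linarith)
    (by rw [Finset.sum_coe_sort J β, Finset.prod_coe_sort J β]; exact hcon)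
  obtain ⟨a, ha, hab, hn⟩ : ∃ a : J → ℤ, a ≠ 0 ∧ (∀ i : J, |(∑ k, (a k : ℝ)) * β i - a i| < β i) ∧
      0 ≤ ∑ k, a k := by
    rcases le_total 0 (∑ k, a0 k) with h | h
    · exact ⟨a0, ha0, hab0, h⟩
    · refine ⟨-a0, by simpa using ha0, ?_, by simpa using h⟩
      intro i
      have := hab0 i
      rw [← abs_neg] at this
      convert this using 2
      simp
      ring
  let A : W → ℤ := fun t => if h : t ∈ J then a ⟨t, h⟩ else 0
  have hAJ : ∀ i : J, A i = a i := by intro i; simp [A]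
  have hAn : ∀ t, t ∉ J → A t = 0 := by intro t ht; simp [A, ht]
  set n : ℤ := ∑ k, a k with hndef
  have hAsum : ∑ t ∈ T, A t = n := by
    rw [← Finset.sum_subset hJ (fun t _ ht => hAn t ht), ← Finset.sum_coe_sort J A]
    exact Finset.sum_congr rfl fun i _ => hAJ i
  have hnR : (∑ k, (a k : ℝ)) = (n : ℝ) := by rw [hndef]; push_cast; rfl
  have hn' : (0:ℝ) ≤ n := by exact_mod_cast hn
  have key := huniq (fun t => (n + 1) * β t - A t) (by
      intro t ht
      have hp := hpos t ht
      by_cases h : t ∈ J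
      · have := hab ⟨t, h⟩
        rw [hnR, abs_lt] at this
        have h2 := hAJ ⟨t, h⟩
        simp only at h2 this
        rw [h2]
        linarith [this.1]
      · rw [hAn t h]; push_cast
        have : 0 ≤ n * β t := by positivity
        linarith) (by
      rw [Finset.sum_sub_distrib, ← Finset.mul_sum, hsum]
      have : ∑ t ∈ T, (A t : ℝ) = n := by rw [← hAsum]; push_cast; rfl
      rw [this]; ring) (by
      have : ∑ t ∈ T, ((n + 1 : ℝ) * β t - A t) • t = (n + 1) • (∑ t ∈ T, β t • t) - ∑ t ∈ T, A t • t := by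
        simp only [sub_smul, mul_smul, Finset.sum_sub_distrib, ← Finset.smul_sum]
        congr 1
        · rw [← Int.cast_smul_eq_zsmul ℝ]; push_cast; rfl
        · exact Finset.sum_congr rfl fun t _ => Int.cast_smul_eq_zsmul ℝ _ _
      rw [this]
      exact Λ.sub_mem (Λ.zsmul_mem hL _) (Λ.sum_mem fun t ht => Λ.zsmul_mem (hlat t ht) _))
  have hn0 : (n : ℝ) = 0 := by
    have h1 := key j hjT
    simp only [hAn j hjJ] at h1
    have h2 := hpos j hjT
    push_cast at h1
    have : n * β j = 0 := by linarith
    rcases mul_eq_zero.1 this with h | h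
    · exact h
    · exact absurd h h2.ne'
  apply ha
  ext i
  have h1 := key i (hJ i.2)
  simp only [hn0, hAJ] at h1
  have : (a i : ℝ) = 0 := by linarith
  exact_mod_cast this

theorem keyLemma {W : Type} [AddCommGroup W] [Module ℝ W] [FiniteDimensional ℝ W]
    (S : ℕ → ℕ) (hS : ∀ r, S r = (∏ i ∈ Finset.range r, S i) + 1)
    (Λ : AddSubgroup W) (Q I : Set W)
    (hQ : Convex ℝ Q) (hF : (Q ∩ Λ).Finite)
    (hI : ∀ a ∈ I, ∀ b ∈ Q, ∀ t : ℝ, 0 < t → t ≤ 1 → t • a + (1 - t) • b ∈ I)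
    (x0 : W) (T0 : Finset W) (β0 : W → ℝ) (h0 : Cand Λ Q I x0 T0 β0) :
    ∃ y ∈ I, y ∈ Λ ∧ ∃ l : ℝ, ∃ q ∈ Q, l ≤ 1 ∧
      1 / (∏ i ∈ Finset.range (Module.finrank ℝ W), (S i : ℝ)) ≤ l ∧ y = l • x0 + (1 - l) • q := by
  classical
  obtain ⟨T, β, h, hAI, hu⟩ := cand_unique Λ Q I hQ hF hI x0 T0 β0 h0
  have hcard : T.card ≤ Module.finrank ℝ W + 1 := by
    by_contra hcon
    push Not at hcon
    obtain ⟨f, h1, h2, t, ht, h3⟩ := Module.exists_nontrivial_relation_sum_zero_of_finrank_succ_lt_card (R := ℝ) hcon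
    exact h3 (hAI f h2 h1 t ht)
  obtain ⟨r, hr⟩ : ∃ r, T.card = r + 1 := ⟨T.card - 1, by
    have := Finset.card_pos.2 ⟨x0, h.mem⟩
    omega⟩
  have hb := elemBoundFinset S hS T β r hr h.pos h.sum
    (prodSum Λ T β h.lat h.pos h.sum h.inL hu) x0 h.mem
  have hS1 : ∀ i, (1:ℝ) ≤ S i := by
    intro i; rw [hS i]; push_cast
    have : (0:ℝ) ≤ ∏ i ∈ Finset.range i, (S i : ℝ) := by positivity
    linarith
  have hmono : ∏ i ∈ Finset.range r, (S i : ℝ) ≤ ∏ i ∈ Finset.range (Module.finrank ℝ W), (S i : ℝ) := by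
    have hm : Monotone fun r => ∏ i ∈ Finset.range r, (S i : ℝ) := by
      apply monotone_nat_of_le_succ
      intro k
      rw [Finset.prod_range_succ]
      exact le_mul_of_one_le_right (by positivity) (hS1 k)
    exact hm (by omega)
  have hpos : 0 < ∏ i ∈ Finset.range r, (S i : ℝ) := Finset.prod_pos fun i _ => by linarith [hS1 i]
  have hle1 : β x0 ≤ 1 := by
    rw [← h.sum]
    exact Finset.single_le_sum (f := β) (fun t ht => (h.pos t ht).le) h.mem
  have hex : ∃ q ∈ Q, ∑ t ∈ T, β t • t = β x0 • x0 + (1 - β x0) • q := by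
    have hs : ∑ t ∈ T.erase x0, β t = 1 - β x0 := by
      rw [← h.sum, ← Finset.add_sum_erase T β h.mem]; ring
    have hs2 := Finset.add_sum_erase T (fun t => β t • t) h.mem
    rcases hle1.eq_or_lt with h1 | h1
    · refine ⟨x0, h.sub x0 h.mem, ?_⟩
      rw [← hs2]
      congr 1
      rw [h1, sub_self] at hs
      have := (Finset.sum_eq_zero_iff_of_nonneg (fun t ht => (h.pos t (Finset.mem_of_mem_erase ht)).le)).1 hs
      rw [h1, sub_self, zero_smul]
      exact Finset.sum_eq_zero fun t ht => by rw [this t ht, zero_smul]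
    · refine ⟨∑ t ∈ T.erase x0, (β t / (1 - β x0)) • t, ?_, ?_⟩
      · apply hQ.sum_mem
        · intro t ht
          exact div_nonneg (h.pos t (Finset.mem_of_mem_erase ht)).le (by linarith)
        · rw [← Finset.sum_div, hs, div_self (by linarith)]
        · intro t ht
          exact h.sub t (Finset.mem_of_mem_erase ht)
      · rw [← hs2, Finset.smul_sum]
        congr 1
        apply Finset.sum_congr rfl
        intro t _
        rw [smul_smul, mul_div_cancel₀]
        linarith
  obtain ⟨q, hq, hq2⟩ := hex
  exact ⟨_, h.inI, h.inL, β x0, q, hq, hle1,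
    (one_div_le_one_div_of_le hpos hmono).trans hb, hq2⟩

/-- Let `P ⊆ ℝ^d` be a `d`-dimensional integral polytope such that
`P' := conv(int P ∩ ℤ^d)` is nonempty, and let `m = ld(P')` be the lattice
diameter of `P'`. Then `ld(P) ≤ (m + 2)(s d - 1)`, where `s` is the Sylvester
sequence. -/
theorem lattice_diameter_bound (d : ℕ) (hd : 1 ≤ d)
    (s : ℕ → ℕ) (hs1 : s 1 = 2)
    (hs : ∀ i, 2 ≤ i → s i = (∏ j ∈ Finset.Icc 1 (i - 1), s j) + 1)
    (V : Finset (Fin d → ℤ))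
    (P : Set (Fin d → ℝ))
    (hP : P = convexHull ℝ ((fun q : Fin d → ℤ => fun j => (q j : ℝ)) '' V))
    (hfull : affineSpan ℝ P = ⊤)
    (P' : Set (Fin d → ℝ))
    (hP' : P' = convexHull ℝ
      {x : Fin d → ℝ | x ∈ interior P ∧ ∀ j, ∃ z : ℤ, x j = (z : ℝ)})
    (hne : P'.Nonempty)
    (m : ℕ) (hm1 : hasCollin d P' m) (hm2 : ∀ n, hasCollin d P' n → n ≤ m) :
    ∀ n, hasCollin d P n → n ≤ (m + 2) * (s d - 1) := by
  classical
  rintro n ⟨p, u, hu, hpu⟩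
  let S : ℕ → ℕ := fun i => s (i + 1)
  have hS : ∀ r, S r = (∏ i ∈ Finset.range r, S i) + 1 := sylProd s hs1 hs
  let ι : (Fin d → ℤ) →+ (Fin d → ℝ) :=
    { toFun := fun q j => (q j : ℝ)
      map_zero' := by ext j; simp
      map_add' := by intro a b; ext j; simp }
  have hιj : ∀ q j, ι q j = (q j : ℝ) := fun _ _ => rfl
  have hιinj : ∀ a, ι a = 0 → a = 0 := by
    intro a h
    ext j
    have := congrFun h j
    rw [hιj, Pi.zero_apply] at this
    exact_mod_cast this
  set U := ι u with hU
  have hU0 : U ≠ 0 := fun h => hu (hιinj u h)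
  let W := (Fin d → ℝ) ⧸ (Submodule.span ℝ {U})
  let π : (Fin d → ℝ) →ₗ[ℝ] W := (Submodule.span ℝ {U}).mkQ
  have hπ : ∀ a b, π a = π b → ∃ c : ℝ, a = b + c • U := by
    intro a b h
    have h1 : a - b ∈ Submodule.span ℝ {U} := (Submodule.Quotient.eq _).1 h
    obtain ⟨c, hc⟩ := Submodule.mem_span_singleton.1 h1
    exact ⟨c, by rw [hc]; abel⟩
  have hπU : π U = 0 := (Submodule.Quotient.mk_eq_zero _).2 (Submodule.mem_span_singleton_self U)
  have hrank : Module.finrank ℝ W = d - 1 := by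
    have h1 := Submodule.finrank_quotient_add_finrank (Submodule.span ℝ {U})
    rw [finrank_span_singleton hU0, Module.finrank_fin_fun] at h1
    show Module.finrank ℝ ((Fin d → ℝ) ⧸ (Submodule.span ℝ {U})) = d - 1
    omega
  have hPimg : P = convexHull ℝ (ι '' (V : Set (Fin d → ℤ))) := hP
  have hPc : Convex ℝ P := by rw [hPimg]; exact convex_convexHull ℝ _
  have hPcompact : IsCompact P := by
    rw [hPimg]; exact ((V.finite_toSet).image ι).isCompact_convexHull ℝ
  let Λ : AddSubgroup W := (π.toAddMonoidHom.comp ι).range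
  have hΛ : ∀ z, π (ι z) ∈ Λ := fun z => ⟨z, rfl⟩
  have hQ : Convex ℝ (π '' P) := hPc.linear_image π
  have hF : ((π '' P) ∩ (Λ : Set W)).Finite := by
    have hK : IsCompact ((fun x : (Fin d → ℝ) × ℝ => x.1 + x.2 • U) '' (P ×ˢ Set.Icc (0:ℝ) 1)) := by
      apply (hPcompact.prod isCompact_Icc).image
      fun_prop
    obtain ⟨R, hR⟩ := hK.isBounded.exists_norm_le
    have hfinZ : {z : Fin d → ℤ | ‖ι z‖ ≤ R}.Finite := by
      apply (Set.Finite.pi' (fun _ : Fin d => Set.finite_Icc (-⌈R⌉) ⌈R⌉)).subset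
      intro z hz j
      have h1 := (norm_le_pi_norm (ι z) j).trans hz
      rw [hιj, Real.norm_eq_abs, abs_le] at h1
      have h2 := Int.le_ceil R
      constructor
      · have : ((-⌈R⌉ : ℤ) : ℝ) ≤ z j := by push_cast; linarith
        exact_mod_cast this
      · have : (z j : ℝ) ≤ ((⌈R⌉ : ℤ) : ℝ) := by linarith
        exact_mod_cast this
    apply (hfinZ.image (fun z => π (ι z))).subset
    rintro w ⟨⟨x, hx, rfl⟩, ⟨z, hz⟩⟩
    have hz : π (ι z) = π x := hz
    obtain ⟨c, hc⟩ := hπ _ _ hz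
    refine ⟨z - ⌊c⌋ • u, ?_, ?_⟩
    · apply hR
      refine ⟨(x, Int.fract c), ⟨hx, Int.fract_nonneg c, (Int.fract_lt_one c).le⟩, ?_⟩
      show x + Int.fract c • U = ι (z - ⌊c⌋ • u)
      rw [map_sub, map_zsmul, hc, ← hU, ← Int.cast_smul_eq_zsmul ℝ, add_sub_assoc, ← sub_smul]
      rfl
    · show π (ι (z - ⌊c⌋ • u)) = π x
      rw [map_sub, map_zsmul, ← hU, map_sub, map_zsmul, hπU, hz]; simp
  have hI : ∀ a ∈ π '' interior P, ∀ b ∈ π '' P, ∀ t : ℝ, 0 < t → t ≤ 1 →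
      t • a + (1 - t) • b ∈ π '' interior P := by
    rintro _ ⟨a, ha, rfl⟩ _ ⟨b, hb, rfl⟩ t ht0 ht1
    exact ⟨t • a + (1 - t) • b,
      hPc.combo_interior_self_mem_interior ha hb ht0 (by linarith) (by ring), by simp⟩
  have hline : ∀ t : ℕ, t ≤ n → ι p + (t : ℝ) • U ∈ P := hpu
  have hp0 : ι p ∈ P := by simpa using hline 0 (Nat.zero_le _)
  have hpn := hline n le_rfl
  obtain ⟨z0, hz0⟩ : ∃ z0, ι z0 ∈ interior P := by
    rw [hP', convexHull_nonempty_iff] at hne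
    obtain ⟨x, hx, hxz⟩ := hne
    choose z hz using hxz
    refine ⟨z, ?_⟩
    have : ι z = x := by ext j; rw [hz j]; rfl
    rwa [this]
  obtain ⟨ε, hε, hεP⟩ : ∃ ε : ℝ, 0 < ε ∧ ι z0 + ε • (ι z0 - ι p) ∈ P := by
    have hcont : Filter.Tendsto (fun ε : ℝ => ι z0 + ε • (ι z0 - ι p)) (nhdsWithin 0 (Set.Ioi 0))
        (nhds (ι z0)) := by
      apply tendsto_nhdsWithin_of_tendsto_nhds
      have : Continuous (fun ε : ℝ => ι z0 + ε • (ι z0 - ι p)) := by fun_prop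
      simpa using this.tendsto 0
    have h1 := hcont.eventually (mem_interior_iff_mem_nhds.1 hz0)
    obtain ⟨ε, h2, h3⟩ := (h1.and self_mem_nhdsWithin).exists
    exact ⟨ε, h3, h2⟩
  obtain ⟨T0, β0, hc0⟩ : ∃ T0 β0, Cand Λ (π '' P) (π '' interior P) (π (ι p)) T0 β0 := by
    let A0 : Finset W := V.image (fun v => π (ι v))
    have hmemA : π (ι z0 + ε • (ι z0 - ι p)) ∈ convexHull ℝ (A0 : Set W) := by
      have h1 : π (ι z0 + ε • (ι z0 - ι p)) ∈ π '' P := ⟨_, hεP, rfl⟩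
      rw [hPimg, LinearMap.image_convexHull, ← Set.image_comp] at h1
      simpa [A0, Function.comp_def] using h1
    obtain ⟨w, hw0, hw1, hw2⟩ := Finset.mem_convexHull'.1 hmemA
    let A := A0.filter (fun t => 0 < w t)
    have hAA : A ⊆ A0 := Finset.filter_subset _ _
    have hout : ∀ t ∈ A0, t ∉ A → w t = 0 := by
      intro t ht ht'
      by_contra hne
      exact ht' (Finset.mem_filter.2 ⟨ht, lt_of_le_of_ne (hw0 t ht) (Ne.symm hne)⟩)
    have hA1 : ∑ t ∈ A, w t = 1 := by rw [Finset.sum_subset hAA hout, hw1]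
    have hA2 : ∑ t ∈ A, w t • t = π (ι z0 + ε • (ι z0 - ι p)) := by
      rw [Finset.sum_subset hAA (fun t ht ht' => by rw [hout t ht ht', zero_smul]), hw2]
    let x0 := π (ι p)
    let γ : W → ℝ := fun t => (if t ∈ A then w t / (1 + ε) else 0) + (if t = x0 then ε / (1 + ε) else 0)
    have hε1 : (1 + ε) ≠ 0 := by positivity
    have hs1 : ∑ t ∈ insert x0 A, γ t = 1 := by
      simp only [γ, Finset.sum_add_distrib]
      rw [Finset.sum_ite_eq' (insert x0 A) x0, if_pos (Finset.mem_insert_self _ _), Finset.sum_ite_mem,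
        Finset.inter_eq_right.2 (Finset.subset_insert _ _), ← Finset.sum_div, hA1]
      field_simp
    have hs2 : ∑ t ∈ insert x0 A, γ t • t = π (ι z0) := by
      simp only [γ, add_smul, ite_smul, zero_smul, Finset.sum_add_distrib]
      rw [Finset.sum_ite_eq' (insert x0 A) x0, if_pos (Finset.mem_insert_self _ _), Finset.sum_ite_mem,
        Finset.inter_eq_right.2 (Finset.subset_insert _ _)]
      have : ∑ t ∈ A, (w t / (1 + ε)) • t = (1 / (1 + ε)) • ∑ t ∈ A, w t • t := by
        rw [Finset.smul_sum]
        apply Finset.sum_congr rfl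
        intro t _
        rw [smul_smul]; congr 1; ring
      rw [this, hA2]
      show (1 / (1 + ε)) • π (ι z0 + ε • (ι z0 - ι p)) + (ε / (1 + ε)) • π (ι p) = _
      rw [← map_smul, ← map_smul, ← map_add]
      congr 1
      ext j
      simp only [Pi.add_apply, Pi.smul_apply, Pi.sub_apply, smul_eq_mul]
      field_simp
      ring
    refine ⟨insert x0 A, γ, ?_⟩
    have hA0 : ∀ t ∈ A, ∃ v ∈ V, π (ι v) = t := fun t ht => Finset.mem_image.1 (hAA ht)
    exact
    { sub := by
        intro t ht
        rcases Finset.mem_insert.1 ht with rfl | ht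
        · exact ⟨_, hp0, rfl⟩
        · obtain ⟨v, hv, rfl⟩ := hA0 t ht
          refine ⟨ι v, ?_, rfl⟩
          rw [hPimg]
          exact subset_convexHull ℝ _ ⟨v, hv, rfl⟩
      lat := by
        intro t ht
        rcases Finset.mem_insert.1 ht with rfl | ht
        · exact hΛ p
        · obtain ⟨v, hv, rfl⟩ := hA0 t ht
          exact hΛ v
      mem := Finset.mem_insert_self _ _
      pos := by
        intro t ht
        have h1 : 0 < ε / (1 + ε) := by positivity
        by_cases h2 : t ∈ A
        · have h3 := (Finset.mem_filter.1 h2).2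
          have h4 : 0 < w t / (1 + ε) := by positivity
          simp only [γ, h2, if_true]
          split_ifs <;> linarith
        · have h3 : t = x0 := by
            rcases Finset.mem_insert.1 ht with h3 | h3
            · exact h3
            · exact absurd h3 h2
          simp only [γ, if_neg h2, if_pos h3]
          linarith
      sum := hs1
      inI := by rw [hs2]; exact ⟨_, hz0, rfl⟩
      inL := by rw [hs2]; exact hΛ z0 }
  obtain ⟨y, ⟨y1, hy1, hy1y⟩, ⟨z, hz⟩, l, _, ⟨q, hq, rfl⟩, hl1, hl, hy⟩ :=
    keyLemma S hS Λ (π '' P) (π '' interior P) hQ hF hI (π (ι p)) T0 β0 hc0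
  have hz : π (ι z) = y := hz
  rw [hrank] at hl
  have hsd : s d - 1 = ∏ i ∈ Finset.range (d - 1), S i := by
    have := hS (d - 1)
    have h2 : S (d - 1) = s d := by simp only [S]; congr 1; omega
    omega
  have hSpos : ∀ i, 0 < S i := fun i => by rw [hS i]; omega
  have hDpos : (0:ℝ) < ∏ i ∈ Finset.range (d - 1), (S i : ℝ) :=
    Finset.prod_pos fun i _ => by exact_mod_cast hSpos i
  have hl0 : 0 < l := lt_of_lt_of_le (one_div_pos.2 hDpos) hl
  obtain ⟨g, hg⟩ := hπ y1 (ι z) (by rw [hy1y, hz])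
  have hAP : l • ι p + (1 - l) • q ∈ P := hPc hp0 hq hl0.le (by linarith) (by ring)
  have hBP : l • (ι p + (n : ℝ) • U) + (1 - l) • q ∈ P := hPc hpn hq hl0.le (by linarith) (by ring)
  obtain ⟨α, hα⟩ := hπ (l • ι p + (1 - l) • q) (ι z) (by rw [hz, hy]; simp)
  have hB' : l • (ι p + (n : ℝ) • U) + (1 - l) • q = ι z + (α + l * n) • U := by
    have : l • (ι p + (n : ℝ) • U) + (1 - l) • q = (l • ι p + (1 - l) • q) + (l * n) • U := by
      rw [smul_add, smul_smul]; abel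
    rw [this, hα, add_smul]; abel
  rw [hB'] at hBP
  rw [hα] at hAP
  rw [hg] at hy1
  have hcomb : ∀ g' : ℝ, ι z + g' • U ∈ P → ∀ a b : ℝ, 0 < a → 0 ≤ b → a + b = 1 →
      ι z + (a * g + b * g') • U ∈ interior P := by
    intro g' hg' a b ha hb hab
    have := hPc.combo_interior_self_mem_interior hy1 hg' ha hb hab
    convert this using 1
    have hb' : b = 1 - a := by linarith
    subst hb'
    module
  have hopen : ∀ τ : ℝ, α < τ → τ < α + l * n → ι z + τ • U ∈ interior P := by
    intro τ h1 h2
    rcases lt_trichotomy τ g with h | h | h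
    · have hpos : 0 < g - α := by linarith
      have := hcomb α hAP ((τ - α) / (g - α)) ((g - τ) / (g - α)) (div_pos (by linarith) hpos)
        (div_nonneg (by linarith) hpos.le) (by field_simp; ring)
      convert this using 3
      field_simp
      ring
    · rw [h]; exact hy1
    · have hpos : 0 < (α + l * n) - g := by linarith
      have := hcomb _ hBP (((α + l * n) - τ) / ((α + l * n) - g)) ((τ - g) / ((α + l * n) - g))
        (div_pos (by linarith) hpos)
        (div_nonneg (by linarith) hpos.le) (by field_simp; ring)
      convert this using 3
      field_simp
      ring
  have hL : l * n ≤ m + 2 := by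
    by_contra hcon
    push Not at hcon
    have : m + 1 ≤ m := by
      apply hm2
      refine ⟨z + (⌊α⌋ + 1) • u, u, hu, ?_⟩
      intro t ht
      rw [hP']
      apply subset_convexHull
      refine ⟨?_, fun j => ⟨(z + (⌊α⌋ + 1) • u) j + t * u j, by push_cast; rfl⟩⟩
      have h1 := Int.lt_floor_add_one α
      have h2 := Int.floor_le α
      have h3 : (t : ℝ) ≤ m + 1 := by exact_mod_cast ht
      have h4 : (0:ℝ) ≤ t := Nat.cast_nonneg t
      have h5 := hopen ((⌊α⌋ : ℝ) + 1 + t) (by linarith) (by linarith)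
      convert h5 using 1
      ext j
      simp only [Pi.add_apply, Pi.smul_apply, smul_eq_mul, hU, hιj]
      push_cast
      ring
    omega
  have hfin : (n : ℝ) ≤ (m + 2) * ∏ i ∈ Finset.range (d - 1), (S i : ℝ) := by
    rw [div_le_iff₀ hDpos] at hl
    have h0 : (0:ℝ) ≤ n := Nat.cast_nonneg n
    calc (n : ℝ) = 1 * n := by ring
      _ ≤ (l * ∏ i ∈ Finset.range (d - 1), (S i : ℝ)) * n := mul_le_mul_of_nonneg_right hl h0
      _ = (l * n) * ∏ i ∈ Finset.range (d - 1), (S i : ℝ) := by ring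
      _ ≤ _ := mul_le_mul_of_nonneg_right hL hDpos.le
  rw [hsd]
  exact_mod_cast hfin
end
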